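/- arXiv:1307.6233 — 4 statements merged into one kernel-verified Lean document; each statement's English description precedes it below -/
import Mathlib

section
/- For every skew shape A there exists a standard Young tableau of shape A whose descent composition α satisfies cols(α) = rows(A)^t. -/
namespace SkewPaper

open Finset

/-- A skew shape `λ/μ`, given by Young diagrams `μ ≤ λ`. -/
structure SkewShape where
  lam : YoungDiagram
  mu : YoungDiagram
  sub : mu ≤ lam

namespace SkewShape

/-- The cells (boxes) of the skew shape `λ/μ`. -/
def cells (A : SkewShape) : Finset (ℕ × ℕ) :=
  A.lam.cells \ A.mu.cells

/-- The number of boxes of `A`. -/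
def size (A : SkewShape) : ℕ := A.cells.card

end SkewShape

/-- The set of columns occupied by row `i` of the cell set `s`. -/
def rowCols (s : Finset (ℕ × ℕ)) (i : ℕ) : Finset ℕ :=
  (s.filter (fun c => c.1 = i)).image Prod.snd

/-- The set of rows occupied by column `j` of the cell set `s`. -/
def colRows (s : Finset (ℕ × ℕ)) (j : ℕ) : Finset ℕ :=
  (s.filter (fun c => c.2 = j)).image Prod.fst

/-- `overlapRow s k i` : the number of columns occupied in common by
rows `i, i+1, …, i+k-1` of `s`. -/
def overlapRow (s : Finset (ℕ × ℕ)) (k i : ℕ) : ℕ :=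
  ((rowCols s i).filter (fun j => ∀ t, t < k → j ∈ rowCols s (i + t))).card

/-- `overlapCol s l j` : the number of rows occupied in common by
columns `j, j+1, …, j+l-1` of `s`. -/
def overlapCol (s : Finset (ℕ × ℕ)) (l j : ℕ) : ℕ :=
  ((colRows s j).filter (fun i => ∀ t, t < l → i ∈ colRows s (j + t))).card

/-- `rows_k`: the partition (as the multiset of its nonzero parts) of overlaps of
`k` consecutive rows. -/
def rowsk (s : Finset (ℕ × ℕ)) (k : ℕ) : Multiset ℕ :=
  ((s.image Prod.fst).val.map (overlapRow s k)).filter (fun m => 0 < m)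

/-- `cols_l`: the partition (as the multiset of its nonzero parts) of overlaps of
`l` consecutive columns. -/
def colsk (s : Finset (ℕ × ℕ)) (l : ℕ) : Multiset ℕ :=
  ((s.image Prod.snd).val.map (overlapCol s l)).filter (fun m => 0 < m)

/-- `rects s k l`: the number of `k × l` rectangles of boxes contained inside `s`. -/
def rects (s : Finset (ℕ × ℕ)) (k l : ℕ) : ℕ :=
  (s.filter (fun c => ∀ a, a < k → ∀ b, b < l → (c.1 + a, c.2 + b) ∈ s)).card

/-- The weakly decreasing sorted list of a multiset: the partition with those parts. -/
def sortDesc (s : Multiset ℕ) : List ℕ := (s.sort (· ≤ ·)).reverse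

/-- Dominance order on partitions presented as multisets of parts:
every partial sum of the decreasing sort of `s` is at most the corresponding
partial sum for `t` (missing parts treated as `0`). -/
def Dom (s t : Multiset ℕ) : Prop :=
  ∀ j : ℕ, ((sortDesc s).take j).sum ≤ ((sortDesc t).take j).sum

/-- The conjugate (transpose) of a partition presented as a multiset of parts. -/
def conjM (s : Multiset ℕ) : Multiset ℕ :=
  (Multiset.range s.sup).map (fun j => Multiset.card (s.filter (fun x => j < x)))

/-- A standard Young tableau of shape `A`: a bijective filling of the cells of `A`
by `1, …, |A|` which increases from left to right along rows and from top to
bottom down columns.  (Entries off the shape are normalized to `0`.) -/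
structure SYT (A : SkewShape) where
  entry : ℕ × ℕ → ℕ
  zero_off : ∀ c, c ∉ A.cells → entry c = 0
  mem_range : ∀ c ∈ A.cells, entry c ∈ Finset.Icc 1 A.size
  injOn : Set.InjOn entry ↑A.cells
  row_lt : ∀ i j j', (i, j) ∈ A.cells → (i, j') ∈ A.cells → j < j' →
    entry (i, j) < entry (i, j')
  col_lt : ∀ i i' j, (i, j) ∈ A.cells → (i', j) ∈ A.cells → i < i' →
    entry (i, j) < entry (i', j)

/-- The descent set of a standard Young tableau: those `k ∈ {1, …, n-1}` such that
`k+1` appears in a strictly lower row than `k`. -/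
def SYT.descentSet {A : SkewShape} (T : SYT A) : Finset ℕ :=
  (Finset.Ico 1 A.size).filter (fun k =>
    ∃ c ∈ A.cells, ∃ c' ∈ A.cells, T.entry c = k ∧ T.entry c' = k + 1 ∧ c.1 < c'.1)

/-- The composition of `n` corresponding to a subset `D ⊆ {1, …, n-1}`:
its partial sums are the elements of `D`. -/
def compOfSet (n : ℕ) (D : Finset ℕ) : List ℕ :=
  if n = 0 then []
  else
    let l := D.sort (· ≤ ·) ++ [n]
    List.zipWith (fun x y => x - y) l (0 :: l)

/-- The descent composition of a standard Young tableau. -/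
def SYT.descentComp {A : SkewShape} (T : SYT A) : List ℕ :=
  compOfSet A.size T.descentSet

/-- The F-support of `A`: the set of descent compositions of SYT of shape `A`. -/
def Fsupp (A : SkewShape) : Set (List ℕ) :=
  {α | ∃ T : SYT A, T.descentComp = α}

/-- The number of standard Young tableaux of shape `A` with descent composition `α`. -/
noncomputable def countSYT (A : SkewShape) (α : List ℕ) : ℕ :=
  Nat.card {T : SYT A // T.descentComp = α}

/-- `S(γ)`: the set of proper partial sums of the composition `γ`. -/
def Sset (γ : List ℕ) : Finset ℕ :=
  ((List.range (γ.length - 1)).map (fun j => (γ.take (j + 1)).sum)).toFinset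

/-- `cols(α)` for a composition `α` of `n`, as a multiset: the parts of the
composition corresponding to the complement of `S(α)` in `{1, …, n-1}`. -/
def colsComp (α : List ℕ) : Multiset ℕ :=
  ↑(compOfSet α.sum ((Finset.Icc 1 (α.sum - 1)) \ Sset α))

/-- Delete the leftmost box of every nonempty row. -/
def trimCells (s : Finset (ℕ × ℕ)) : Finset (ℕ × ℕ) :=
  s.filter (fun c => 1 ≤ c.2 ∧ (c.1, c.2 - 1) ∈ s)

/-- `s` is a ribbon whose (nonempty) rows are exactly rows `r0, …, r1`, with every
pair of adjacent rows overlapping in exactly one column. -/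
def IsRibbonOn (s : Finset (ℕ × ℕ)) (r0 r1 : ℕ) : Prop :=
  r0 ≤ r1 ∧ (∀ i, (rowCols s i).Nonempty ↔ r0 ≤ i ∧ i ≤ r1) ∧
    (∀ i, r0 ≤ i → i < r1 → (rowCols s i ∩ rowCols s (i + 1)).card = 1)

/-- `A` is a ribbon. -/
def SkewShape.IsRibbon (A : SkewShape) : Prop :=
  ∃ r0 r1, IsRibbonOn A.cells r0 r1

/-- An elongated ribbon: a ribbon all of whose rows have length at least two. -/
def ElongatedRibbon (A : SkewShape) : Prop :=
  A.IsRibbon ∧ ∀ i, (rowCols A.cells i).Nonempty → 2 ≤ (rowCols A.cells i).card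

/-- A horizontal strip: at most one box in each column. -/
def IsHorizontalStrip (A : SkewShape) : Prop :=
  ∀ j, (colRows A.cells j).card ≤ 1

/-- `A` is F-multiplicity-free: distinct SYT of shape `A` have distinct descent sets. -/
def FMultFree (A : SkewShape) : Prop :=
  ∀ T T' : SYT A, T.descentSet = T'.descentSet → T = T'

/-- The cells of a shape, viewed inside `ℤ × ℤ`. -/
def toZ (s : Finset (ℕ × ℕ)) : Finset (ℤ × ℤ) :=
  s.image (fun c => ((c.1 : ℤ), (c.2 : ℤ)))

/-- The cells of the hook `(m, 1^l)`. -/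
def hookCells (m l : ℕ) : Finset (ℕ × ℕ) :=
  ((Finset.range m).image (fun j => ((0 : ℕ), j))) ∪
    ((Finset.Icc 1 l).image (fun i => (i, (0 : ℕ))))

/-- Partial sums of the list of successive differences of a strictly increasing list. -/
theorem add_sum_take_zipWith_sub (l : List ℕ) (a : ℕ) (h : (a :: l).Pairwise (· < ·)) (j : ℕ)
    (hj : j < l.length) :
    a + ((List.zipWith (fun x y => x - y) l (a :: l)).take (j + 1)).sum = l[j] := by
  induction l generalizing a j with
  | nil => simp at hj
  | cons x l ih =>
    have hax : a < x := by
      rw [List.pairwise_cons] at h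
      exact h.1 x (by simp)
    cases j with
    | zero => simp; omega
    | succ j =>
      have := ih x (List.pairwise_cons.1 h).2 j (by simpa using hj)
      simp only [List.zipWith_cons_cons, List.take_succ_cons, List.sum_cons,
        List.getElem_cons_succ] at this ⊢
      omega

theorem pairwise_zero_cons_sort_append {n : ℕ} (hn : 0 < n) {D : Finset ℕ}
    (hD : D ⊆ Ico 1 n) : (0 :: (D.sort (· ≤ ·) ++ [n])).Pairwise (· < ·) := by
  rw [List.pairwise_cons, List.pairwise_append]
  refine ⟨?_, D.sortedLT_sort.pairwise, by simp, ?_⟩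
  · intro x hx
    rcases List.mem_append.1 hx with hx | hx
    · have := mem_Ico.1 (hD ((D.mem_sort _).1 hx)); omega
    · simp at hx; omega
  · intro x hx y hy
    have := mem_Ico.1 (hD ((D.mem_sort _).1 hx))
    simp at hy; omega

theorem length_compOfSet {n : ℕ} (hn : 0 < n) (D : Finset ℕ) :
    (compOfSet n D).length = D.card + 1 := by
  simp [compOfSet, hn.ne']

theorem sum_take_compOfSet {n : ℕ} (hn : 0 < n) {D : Finset ℕ} (hD : D ⊆ Ico 1 n) (j : ℕ)
    (hj : j < (D.sort (· ≤ ·) ++ [n]).length) :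
    ((compOfSet n D).take (j + 1)).sum = (D.sort (· ≤ ·) ++ [n])[j] := by
  have := add_sum_take_zipWith_sub _ 0 (pairwise_zero_cons_sort_append hn hD) j hj
  simpa [compOfSet, hn.ne'] using this

theorem sum_compOfSet {n : ℕ} (hn : 0 < n) {D : Finset ℕ} (hD : D ⊆ Ico 1 n) :
    (compOfSet n D).sum = n := by
  have h := sum_take_compOfSet hn hD D.card (by simp)
  rw [List.take_of_length_le (by rw [length_compOfSet hn])] at h
  rw [h]
  simp

theorem Sset_compOfSet {n : ℕ} (hn : 0 < n) {D : Finset ℕ} (hD : D ⊆ Ico 1 n) :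
    Sset (compOfSet n D) = D := by
  ext x
  simp only [Sset, length_compOfSet hn, Nat.add_sub_cancel, List.mem_toFinset, List.mem_map,
    List.mem_range]
  have key : ∀ j (hj : j < D.card), ((compOfSet n D).take (j + 1)).sum
      = (D.sort (· ≤ ·))[j]'(by simpa using hj) := by
    intro j hj
    rw [sum_take_compOfSet hn hD j (by simp; omega), List.getElem_append_left]
  rw [← D.mem_sort (· ≤ ·), List.mem_iff_getElem]
  constructor
  · rintro ⟨j, hj, rfl⟩
    exact ⟨j, by simpa using hj, (key j hj).symm⟩
  · rintro ⟨j, hj, rfl⟩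
    exact ⟨j, by simpa using hj, key j (by simpa using hj)⟩

theorem sum_take_map_range (s : ℕ → ℕ) {K j : ℕ} (hj : j ≤ K) :
    (((List.range K).map s).take j).sum = ∑ m ∈ range j, s m := by
  rw [← List.map_take, List.take_range, min_eq_left hj]
  rfl

theorem mem_Sset_map_range (s : ℕ → ℕ) (K x : ℕ) :
    x ∈ Sset ((List.range K).map s) ↔ ∃ j, j + 1 < K ∧ ∑ m ∈ range (j + 1), s m = x := by
  simp only [Sset, List.length_map, List.length_range, List.mem_toFinset, List.mem_map,
    List.mem_range]
  constructor
  · rintro ⟨j, hj, rfl⟩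
    exact ⟨j, by omega, (sum_take_map_range s (by omega)).symm⟩
  · rintro ⟨j, hj, rfl⟩
    exact ⟨j, by omega, sum_take_map_range s (by omega)⟩

theorem sum_range_lt_sum_range {s : ℕ → ℕ} {K : ℕ} (hs : ∀ k < K, 0 < s k) {a b : ℕ}
    (hab : a < b) (hb : b ≤ K) : ∑ m ∈ range a, s m < ∑ m ∈ range b, s m := by
  have h1 : ∑ m ∈ range a, s m < ∑ m ∈ range (a + 1), s m := by
    rw [sum_range_succ]; have := hs a (by omega); omega
  exact h1.trans_le (sum_le_sum_of_subset (range_subset_range.2 hab))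

theorem compOfSet_Sset_map_range {s : ℕ → ℕ} {K : ℕ} (hK : 0 < K) (hs : ∀ k < K, 0 < s k) :
    compOfSet (∑ m ∈ range K, s m) (Sset ((List.range K).map s)) = (List.range K).map s := by
  have hn : 0 < ∑ m ∈ range K, s m := by
    simpa using sum_range_lt_sum_range hs hK le_rfl
  set p : List ℕ := (List.range (K - 1)).map fun j => ∑ m ∈ range (j + 1), s m with hp
  have hS : Sset ((List.range K).map s) = p.toFinset := by
    ext x
    rw [mem_Sset_map_range]
    simp [hp, Nat.lt_sub_iff_add_lt]
  have hpw : p.Pairwise (· < ·) := by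
    rw [hp, List.pairwise_iff_getElem]
    intro i j hi hj hij
    simp only [List.length_map, List.length_range] at hi hj
    simpa using sum_range_lt_sum_range hs (Nat.succ_lt_succ hij) (by omega)
  have hsort : (Sset ((List.range K).map s)).sort (· ≤ ·) = p := by
    rw [hS]
    exact (List.toFinset_sort _ (hpw.imp fun h => h.ne)).2 (hpw.imp fun h => h.le)
  have hl : p ++ [∑ m ∈ range K, s m]
      = (List.range K).map fun j => ∑ m ∈ range (j + 1), s m := by
    obtain ⟨K, rfl⟩ : ∃ k, K = k + 1 := ⟨K - 1, by omega⟩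
    simp [hp, List.range_succ]
  rw [compOfSet, if_neg hn.ne']
  simp only [hsort, hl]
  apply List.ext_getElem
  · simp
  · intro i h1 h2
    cases i with
    | zero => simp
    | succ i => simp [sum_range_succ _ (i + 1)]

namespace SkewShape

variable (A : SkewShape)

theorem mem_cells {i j : ℕ} : (i, j) ∈ A.cells ↔ A.mu.rowLen i ≤ j ∧ j < A.lam.rowLen i := by
  simp only [cells, mem_sdiff, YoungDiagram.mem_cells, YoungDiagram.mem_iff_lt_rowLen]
  omega

/-- The length of row `i` of `A`. -/
def rowLength (i : ℕ) : ℕ := A.lam.rowLen i - A.mu.rowLen i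

/-- The rows of `A` with more than `k` boxes. -/
def longRows (k : ℕ) : Finset ℕ := (A.cells.image Prod.fst).filter (k < A.rowLength ·)

/-- The length of the longest row of `A`. -/
def maxRowLength : ℕ := (rowsk A.cells 1).sup

/-- The number of boxes of `A` with fewer than `k` boxes to their left. -/
def prefixSize (k : ℕ) : ℕ := ∑ m ∈ range k, (A.longRows m).card

/-- The number of boxes of `A` to the left of the box `c` in its row. -/
def leftIndex (c : ℕ × ℕ) : ℕ := c.2 - A.mu.rowLen c.1

theorem overlapRow_one (i : ℕ) : overlapRow A.cells 1 i = A.rowLength i := by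
  rw [overlapRow, rowLength, ← Nat.card_Ico]
  congr 1
  ext j
  simp [rowCols, A.mem_cells]

theorem card_filter_rowsk (k : ℕ) :
    Multiset.card ((rowsk A.cells 1).filter (k < ·)) = (A.longRows k).card := by
  have : overlapRow A.cells 1 = A.rowLength := funext A.overlapRow_one
  rw [rowsk, this, Multiset.filter_filter, Multiset.filter_map, Multiset.card_map, longRows,
    Finset.card_def, Finset.filter_val]
  congr 1
  apply Multiset.filter_congr
  intro x _
  simp only [Function.comp]
  omega

theorem conjM_rowsk :
    conjM (rowsk A.cells 1)
      = ((List.range A.maxRowLength).map fun k => (A.longRows k).card : List ℕ) := by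
  simp only [conjM, A.card_filter_rowsk, maxRowLength]
  rfl

theorem card_longRows_pos {k : ℕ} (hk : k < A.maxRowLength) : 0 < (A.longRows k).card := by
  rw [← card_filter_rowsk, Multiset.card_pos_iff_exists_mem]
  by_contra! h
  refine hk.not_ge (Multiset.sup_le.2 fun x hx => ?_)
  by_contra! hx'
  exact h x (Multiset.mem_filter.2 ⟨hx, hx'⟩)

theorem longRows_anti {k k' : ℕ} (h : k ≤ k') : A.longRows k' ⊆ A.longRows k := by
  intro i hi
  simp only [longRows, mem_filter] at hi ⊢
  exact ⟨hi.1, by omega⟩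

theorem prefixSize_succ (k : ℕ) :
    A.prefixSize (k + 1) = A.prefixSize k + (A.longRows k).card := sum_range_succ _ _

theorem prefixSize_mono : Monotone A.prefixSize := fun _ _ h =>
  sum_le_sum_of_subset (range_subset_range.2 h)

variable {A}

theorem fst_mem_longRows {c : ℕ × ℕ} (hc : c ∈ A.cells) :
    c.1 ∈ A.longRows (A.leftIndex c) := by
  obtain ⟨i, j⟩ := c
  have := A.mem_cells.1 hc
  rw [longRows, mem_filter, leftIndex, rowLength]
  exact ⟨mem_image_of_mem Prod.fst hc, by dsimp only; omega⟩

theorem leftIndex_lt {c : ℕ × ℕ} (hc : c ∈ A.cells) : A.leftIndex c < A.maxRowLength := by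
  have h := fst_mem_longRows hc
  have hpos : 0 < (A.longRows (A.leftIndex c)).card := card_pos.2 ⟨_, h⟩
  rw [← card_filter_rowsk, Multiset.card_pos_iff_exists_mem] at hpos
  obtain ⟨x, hx⟩ := hpos
  rw [Multiset.mem_filter] at hx
  exact hx.2.trans_le (Multiset.le_sup hx.1)

theorem eq_of_leftIndex_eq {c c' : ℕ × ℕ} (hc : c ∈ A.cells) (hc' : c' ∈ A.cells)
    (h : A.leftIndex c = A.leftIndex c') (h1 : c.1 = c'.1) : c = c' := by
  obtain ⟨i, j⟩ := c
  obtain ⟨i', j'⟩ := c'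
  obtain rfl : i = i' := h1
  have := A.mem_cells.1 hc
  have := A.mem_cells.1 hc'
  simp only [leftIndex] at h
  rw [Prod.mk.injEq]
  omega

variable (A)

theorem prefixSize_maxRowLength : A.prefixSize A.maxRowLength = A.size := by
  rw [size, card_eq_sum_card_fiberwise (f := A.leftIndex) (t := range A.maxRowLength)
    (fun c hc => by simpa using leftIndex_lt hc), prefixSize]
  refine sum_congr rfl fun k _ => ?_
  symm
  refine card_bij (fun c _ => c.1) ?_ ?_ ?_
  · intro c hc
    rw [mem_filter] at hc
    exact hc.2 ▸ fst_mem_longRows hc.1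
  · intro c hc c' hc' h
    rw [mem_filter] at hc hc'
    exact eq_of_leftIndex_eq hc.1 hc'.1 (hc.2.trans hc'.2.symm) h
  · intro i hi
    rw [longRows, mem_filter, rowLength] at hi
    refine ⟨(i, A.mu.rowLen i + k), ?_, rfl⟩
    rw [mem_filter, A.mem_cells]
    simp only [leftIndex]
    omega

/-- The position of the box `c` when the boxes of `A` are read in order of their position within
their row, from top to bottom among those of equal position. -/
def stripEntry (c : ℕ × ℕ) : ℕ :=
  A.prefixSize (A.leftIndex c) + ((A.longRows (A.leftIndex c)).filter (· ≤ c.1)).card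

variable {A}

theorem prefixSize_lt_stripEntry {c : ℕ × ℕ} (hc : c ∈ A.cells) :
    A.prefixSize (A.leftIndex c) < A.stripEntry c := by
  have : 0 < ((A.longRows (A.leftIndex c)).filter (· ≤ c.1)).card :=
    card_pos.2 ⟨c.1, mem_filter.2 ⟨fst_mem_longRows hc, le_rfl⟩⟩
  rw [stripEntry]
  omega

theorem stripEntry_le (c : ℕ × ℕ) :
    A.stripEntry c ≤ A.prefixSize (A.leftIndex c + 1) := by
  rw [prefixSize_succ, stripEntry]
  exact Nat.add_le_add_left (card_filter_le _ _) _

theorem stripEntry_lt_prefixSize_succ {c : ℕ × ℕ} {i : ℕ} (hi : i ∈ A.longRows (A.leftIndex c))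
    (h : c.1 < i) : A.stripEntry c < A.prefixSize (A.leftIndex c + 1) := by
  rw [prefixSize_succ, stripEntry]
  refine Nat.add_lt_add_left (card_lt_card ?_) _
  exact filter_ssubset.2 ⟨i, hi, by omega⟩

theorem stripEntry_lt_of_leftIndex_lt {c c' : ℕ × ℕ} (hc' : c' ∈ A.cells)
    (h : A.leftIndex c < A.leftIndex c') : A.stripEntry c < A.stripEntry c' :=
  ((stripEntry_le c).trans (A.prefixSize_mono h)).trans_lt (prefixSize_lt_stripEntry hc')

theorem stripEntry_le_of_fst_le {c c' : ℕ × ℕ} (h : A.leftIndex c = A.leftIndex c')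
    (h1 : c.1 ≤ c'.1) : A.stripEntry c ≤ A.stripEntry c' := by
  rw [stripEntry, stripEntry, h]
  refine Nat.add_le_add_left (card_le_card ?_) _
  exact monotone_filter_right _ fun i _ hi => hi.trans h1

theorem stripEntry_lt_of_fst_lt {c c' : ℕ × ℕ} (hc' : c' ∈ A.cells)
    (h : A.leftIndex c ≤ A.leftIndex c') (h1 : c.1 < c'.1) :
    A.stripEntry c < A.stripEntry c' := by
  rcases h.lt_or_eq with h | h
  · exact stripEntry_lt_of_leftIndex_lt hc' h
  rw [stripEntry, stripEntry, h]
  refine Nat.add_lt_add_left (card_lt_card ?_) _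
  refine (ssubset_iff_of_subset (monotone_filter_right _ fun i _ hi => hi.trans h1.le)).2
    ⟨c'.1, mem_filter.2 ⟨fst_mem_longRows hc', le_rfl⟩, ?_⟩
  simp only [mem_filter, not_and]
  omega

theorem stripEntry_injOn : Set.InjOn A.stripEntry ↑A.cells := by
  intro c hc c' hc' h
  rw [mem_coe] at hc hc'
  rcases lt_trichotomy (A.leftIndex c) (A.leftIndex c') with hk | hk | hk
  · exact absurd h (stripEntry_lt_of_leftIndex_lt hc' hk).ne
  · rcases lt_trichotomy c.1 c'.1 with h1 | h1 | h1
    · exact absurd h (stripEntry_lt_of_fst_lt hc' hk.le h1).ne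
    · exact eq_of_leftIndex_eq hc hc' hk h1
    · exact absurd h (stripEntry_lt_of_fst_lt hc hk.ge h1).ne'
  · exact absurd h (stripEntry_lt_of_leftIndex_lt hc hk).ne'

theorem stripEntry_mem {c : ℕ × ℕ} (hc : c ∈ A.cells) : A.stripEntry c ∈ Icc 1 A.size := by
  rw [mem_Icc, ← prefixSize_maxRowLength]
  exact ⟨(Nat.zero_le _).trans_lt (prefixSize_lt_stripEntry hc),
    (stripEntry_le c).trans (A.prefixSize_mono (leftIndex_lt hc))⟩

theorem exists_stripEntry_eq {v : ℕ} (hv : v ∈ Icc 1 A.size) :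
    ∃ c ∈ A.cells, A.stripEntry c = v := by
  have := surjOn_of_injOn_of_card_le (s := A.cells) (t := Icc 1 A.size) A.stripEntry
    (fun c hc => by simpa using stripEntry_mem hc) stripEntry_injOn (by simp [size])
  obtain ⟨c, hc, h⟩ := this (mem_coe.2 hv)
  exact ⟨c, hc, h⟩

variable (A)

/-- The standard Young tableau of shape `A` filled by first boxes of rows, then second boxes of
rows, and so on, each time from top to bottom. -/
def stripSYT : SYT A where
  entry c := if c ∈ A.cells then A.stripEntry c else 0
  zero_off c hc := if_neg hc
  mem_range c hc := by rw [if_pos hc]; exact stripEntry_mem hc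
  injOn := stripEntry_injOn.congr fun c hc => (if_pos (mem_coe.1 hc)).symm
  row_lt i j j' h h' hj := by
    rw [if_pos h, if_pos h']
    apply stripEntry_lt_of_leftIndex_lt h'
    have := A.mem_cells.1 h
    simp only [leftIndex]
    omega
  col_lt i i' j h h' hi := by
    rw [if_pos h, if_pos h']
    refine stripEntry_lt_of_fst_lt h' ?_ hi
    exact Nat.sub_le_sub_left (A.mu.rowLen_anti i i' hi.le) _

theorem prefixSize_strictMono {a b : ℕ} (hab : a < b) (hb : b ≤ A.maxRowLength) :
    A.prefixSize a < A.prefixSize b :=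
  sum_range_lt_sum_range (fun _ => A.card_longRows_pos) hab hb

theorem descentSet_stripSYT :
    A.stripSYT.descentSet = Ico 1 A.size \
      Sset ((List.range A.maxRowLength).map fun k => (A.longRows k).card) := by
  ext v
  simp only [SYT.descentSet, mem_filter, mem_sdiff, mem_Ico, mem_Sset_map_range]
  refine and_congr_right fun hv => ?_
  constructor
  · rintro ⟨c, hc, c', hc', h, h', hlt⟩ ⟨m, hm, hP⟩
    change A.prefixSize (m + 1) = v at hP
    simp only [stripSYT, if_pos hc, if_pos hc'] at h h'
    have hk : A.leftIndex c ≤ m := by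
      by_contra! hk
      have := A.prefixSize_mono (show m + 1 ≤ _ from hk)
      have := prefixSize_lt_stripEntry hc
      omega
    have hk' : m ≤ A.leftIndex c := by
      by_contra! hk'
      have := A.prefixSize_strictMono (Nat.succ_lt_succ hk') hm.le
      have := stripEntry_le (A := A) c
      simp only [Nat.succ_eq_add_one] at *
      omega
    obtain rfl := hk.antisymm hk'
    have hcc : A.leftIndex c ≤ A.leftIndex c' := by
      by_contra! hcc
      have := stripEntry_lt_of_leftIndex_lt hc hcc
      omega
    have := stripEntry_lt_prefixSize_succ (A.longRows_anti hcc (fst_mem_longRows hc')) hlt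
    omega
  · intro hP
    obtain ⟨c, hc, h⟩ := exists_stripEntry_eq (A := A) (v := v) (mem_Icc.2 ⟨hv.1, hv.2.le⟩)
    obtain ⟨c', hc', h'⟩ := exists_stripEntry_eq (A := A) (v := v + 1)
      (mem_Icc.2 ⟨by omega, hv.2⟩)
    refine ⟨c, hc, c', hc', (if_pos hc).trans h, (if_pos hc').trans h', ?_⟩
    rcases lt_trichotomy (A.leftIndex c) (A.leftIndex c') with hk | hk | hk
    · refine absurd ⟨A.leftIndex c, (Nat.succ_le_of_lt hk).trans_lt (leftIndex_lt hc'), ?_⟩ hP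
      change A.prefixSize (A.leftIndex c + 1) = v
      have := stripEntry_le (A := A) c
      have := A.prefixSize_mono (Nat.succ_le_of_lt hk)
      have := prefixSize_lt_stripEntry hc'
      simp only [Nat.succ_eq_add_one] at *
      omega
    · by_contra! h1
      have := stripEntry_le_of_fst_le hk.symm h1
      omega
    · have := stripEntry_lt_of_leftIndex_lt hc hk
      omega

end SkewShape

theorem stmt8 (A : SkewShape) :
    ∃ T : SYT A, colsComp T.descentComp = conjM (rowsk A.cells 1) := by
  refine ⟨A.stripSYT, ?_⟩
  rw [A.conjM_rowsk]
  have hsize := A.prefixSize_maxRowLength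
  rcases Nat.eq_zero_or_pos A.maxRowLength with hK | hK
  · have hn : A.size = 0 := by rw [← hsize, hK]; rfl
    simp [colsComp, SYT.descentComp, compOfSet, hn, hK]
  have hn : 0 < A.size := by
    rw [← hsize]
    exact (Nat.zero_le _).trans_lt (A.prefixSize_strictMono hK le_rfl)
  have hD : A.stripSYT.descentSet ⊆ Ico 1 A.size := filter_subset _ _
  have hS : Sset ((List.range A.maxRowLength).map fun k => (A.longRows k).card)
      ⊆ Icc 1 (A.size - 1) := by
    intro x hx
    obtain ⟨j, hj, rfl⟩ := (mem_Sset_map_range _ _ _).1 hx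
    have h1 := A.prefixSize_strictMono (Nat.succ_pos j) hj.le
    have h2 := A.prefixSize_strictMono hj le_rfl
    rw [hsize] at h2
    change A.prefixSize (j + 1) ∈ _
    rw [mem_Icc]
    simp only [Nat.succ_eq_add_one] at *
    omega
  have hI : Ico 1 A.size = Icc 1 (A.size - 1) := by
    ext x
    simp only [mem_Ico, mem_Icc]
    omega
  rw [colsComp, SYT.descentComp, sum_compOfSet hn hD, Sset_compOfSet hn hD,
    A.descentSet_stripSYT, hI, Finset.sdiff_sdiff_eq_self hS, ← hsize]
  exact congrArg _ (compOfSet_Sset_map_range hK fun _ => A.card_longRows_pos)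

end SkewPaper
end

section
/- Let A and B be skew shapes. If Fsupp(A) ⊇ Fsupp(B), then rows(A) ⊴ rows(B) and cols(A) ⊴ cols(B) in dominance order. -/
namespace SkewPaper

open Finset

theorem zipWith_sub_cons_injective {l l' : List ℕ} {a : ℕ} (hl : (a :: l).Pairwise (· ≤ ·))
    (hl' : (a :: l').Pairwise (· ≤ ·))
    (h : List.zipWith (fun x y => x - y) l (a :: l) =
      List.zipWith (fun x y => x - y) l' (a :: l')) : l = l' := by
  induction l generalizing a l' with
  | nil => cases l' <;> simp_all
  | cons x l ih =>
    cases l' with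
    | nil => simp at h
    | cons y l' =>
      simp only [List.zipWith_cons_cons, List.cons.injEq] at h
      have h1 := (List.pairwise_cons.1 hl).1 x (by simp)
      have h2 := (List.pairwise_cons.1 hl').1 y (by simp)
      obtain rfl : x = y := by omega
      rw [ih (List.pairwise_cons.1 hl).2 (List.pairwise_cons.1 hl').2 h.2]

theorem pairwise_le_sort_append {n : ℕ} {D : Finset ℕ} (hD : D ⊆ Ico 1 n) :
    (0 :: (D.sort (· ≤ ·) ++ [n])).Pairwise (· ≤ ·) := by
  rw [List.pairwise_cons, List.pairwise_append]
  refine ⟨fun _ _ => Nat.zero_le _, D.pairwise_sort _, by simp, ?_⟩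
  intro a ha b hb
  have := mem_Ico.1 (hD ((mem_sort _).1 ha))
  simp only [List.mem_singleton] at hb
  omega

theorem compOfSet_injective {n m : ℕ} {D E : Finset ℕ} (hD : D ⊆ Ico 1 n) (hE : E ⊆ Ico 1 m)
    (h : compOfSet n D = compOfSet m E) : n = m ∧ D = E := by
  unfold compOfSet at h
  have hne : ∀ (F : Finset ℕ) (k : ℕ), List.zipWith (fun x y => x - y)
      (F.sort (· ≤ ·) ++ [k]) (0 :: (F.sort (· ≤ ·) ++ [k])) ≠ [] := by
    intro F k
    rw [Ne, List.zipWith_eq_nil_iff]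
    simp
  split_ifs at h with hn hm hm
  · subst hn hm
    simp_all
  · exact absurd h.symm (hne _ _)
  · exact absurd h (hne _ _)
  · have := zipWith_sub_cons_injective (pairwise_le_sort_append hD) (pairwise_le_sort_append hE) h
    obtain ⟨h1, h2⟩ := List.append_inj' this rfl
    refine ⟨by simpa using h2, ?_⟩
    rw [← sort_toFinset (r := (· ≤ ·)) D, h1, sort_toFinset]

theorem sum_le_mul_add_sum_tsub (l : List ℕ) (j k : ℕ) :
    (l.take j).sum ≤ j * k + (l.map (fun x => x - k)).sum := by
  induction l generalizing j with
  | nil => simp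
  | cons x l ih =>
    cases j with
    | zero => simp
    | succ j =>
      have := ih j
      simp only [List.take_succ_cons, List.sum_cons, List.map_cons, add_mul]
      omega

theorem sum_tsub_add_sum_min (l : List ℕ) (k : ℕ) :
    (l.map (fun x => x - k)).sum + (l.map (min k)).sum = l.sum := by
  induction l with
  | nil => simp
  | cons x l ih =>
    simp only [List.map_cons, List.sum_cons]
    omega

theorem sum_map_tsub_eq_zero {l : List ℕ} {k : ℕ} (h : ∀ x ∈ l, x ≤ k) :
    (l.map (fun x => x - k)).sum = 0 := by
  rw [List.sum_eq_zero_iff]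
  intro y hy
  obtain ⟨x, hx, rfl⟩ := List.mem_map.1 hy
  have := h x hx
  omega

theorem exists_sum_take_eq {l : List ℕ} (hl : l.Pairwise (· ≥ ·)) (j : ℕ) :
    ∃ k, (l.take j).sum = j * k + (l.map (fun x => x - k)).sum := by
  induction l generalizing j with
  | nil => exact ⟨0, by simp⟩
  | cons x l ih =>
    obtain ⟨hx, hl⟩ := List.pairwise_cons.1 hl
    rcases j with _ | _ | j
    · refine ⟨x, ?_⟩
      rw [sum_map_tsub_eq_zero]
      · simp
      · simpa using hx
    · refine ⟨x, ?_⟩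
      rw [sum_map_tsub_eq_zero]
      · simp
      · simpa using hx
    · obtain ⟨k, hk⟩ := ih hl (j + 1)
      by_cases hkx : k ≤ x
      · refine ⟨k, ?_⟩
        simp only [List.take_succ_cons, List.sum_cons, List.map_cons, add_mul] at hk ⊢
        omega
      · refine ⟨x, ?_⟩
        have h1 := sum_le_mul_add_sum_tsub l (j + 1) x
        rw [sum_map_tsub_eq_zero hx] at h1
        have h2 : (j + 1) * x ≤ (j + 1) * k := Nat.mul_le_mul_left _ (by omega)
        rw [List.map_cons, List.sum_cons, sum_map_tsub_eq_zero hx, List.take_succ_cons,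
          List.sum_cons, Nat.sub_self, add_mul (j + 1) 1 x]
        omega

theorem coe_sortDesc (s : Multiset ℕ) : (sortDesc s : Multiset ℕ) = s := by
  rw [sortDesc, Multiset.coe_reverse, Multiset.sort_eq]

theorem pairwise_sortDesc (s : Multiset ℕ) : (sortDesc s).Pairwise (· ≥ ·) := by
  rw [sortDesc, List.pairwise_reverse]
  exact s.pairwise_sort _

theorem dom_of_sum_min_le {s t : Multiset ℕ} (hst : s.sum = t.sum)
    (h : ∀ k, (t.map (min k)).sum ≤ (s.map (min k)).sum) : Dom s t := by
  intro j
  obtain ⟨k, hk⟩ := exists_sum_take_eq (pairwise_sortDesc t) j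
  have h1 := sum_le_mul_add_sum_tsub (sortDesc s) j k
  have h2 := sum_tsub_add_sum_min (sortDesc s) k
  have h3 := sum_tsub_add_sum_min (sortDesc t) k
  have h4 := h k
  rw [← coe_sortDesc s, ← coe_sortDesc t] at h4 hst
  simp only [Multiset.map_coe, Multiset.sum_coe] at h4 hst
  omega

theorem overlapCol_one (s : Finset (ℕ × ℕ)) (j : ℕ) :
    overlapCol s 1 j = #{c ∈ s | c.2 = j} := by
  unfold overlapCol
  rw [filter_true_of_mem]
  · unfold colRows
    refine card_image_of_injOn ?_
    rintro ⟨a, b⟩ h ⟨a', b'⟩ h' haa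
    simp_all
  · intro i hi t ht
    obtain rfl : t = 0 := by omega
    simpa using hi

theorem sum_map_filter_pos (m : Multiset ℕ) {f : ℕ → ℕ} (hf : f 0 = 0) :
    ((m.filter (fun x => 0 < x)).map f).sum = (m.map f).sum := by
  induction m using Multiset.induction_on with
  | empty => simp
  | cons a m ih =>
    rcases Nat.eq_zero_or_pos a with rfl | ha
    · simp [ih, hf]
    · simp [ih, ha]

theorem sum_map_colsk_one (s : Finset (ℕ × ℕ)) {f : ℕ → ℕ} (hf : f 0 = 0) :
    ((colsk s 1).map f).sum = ∑ j ∈ s.image Prod.snd, f #{c ∈ s | c.2 = j} := by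
  unfold colsk
  rw [sum_map_filter_pos _ hf, Multiset.map_map]
  simp only [Function.comp_def, overlapCol_one]
  rfl

theorem sum_colsk_one (s : Finset (ℕ × ℕ)) : (colsk s 1).sum = #s := by
  have := sum_map_colsk_one s (f := id) rfl
  rw [Multiset.map_id] at this
  rw [this]
  exact (card_eq_sum_card_image Prod.snd s).symm

theorem rowsk_eq_colsk_of_swap {s t : Finset (ℕ × ℕ)} (h : t = s.image Prod.swap) (k : ℕ) :
    rowsk s k = colsk t k := by
  subst h
  have hrow : ∀ i, rowCols s i = colRows (s.image Prod.swap) i := by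
    intro i
    ext j
    simp [rowCols, colRows]
  have hov : overlapRow s k = overlapCol (s.image Prod.swap) k := by
    funext i
    simp only [overlapRow, overlapCol, hrow]
  have himg : s.image Prod.fst = (s.image Prod.swap).image Prod.snd := by
    rw [image_image]
    rfl
  rw [rowsk, colsk, hov, himg]

namespace SYT

variable {A B : SkewShape}

theorem exists_entry_eq (T : SYT A) {v : ℕ} (h1 : 1 ≤ v) (h2 : v ≤ A.size) :
    ∃ c ∈ A.cells, T.entry c = v := by
  have h : A.cells.image T.entry = Icc 1 A.size := by
    apply eq_of_subset_of_card_le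
    · intro x hx
      obtain ⟨c, hc, rfl⟩ := mem_image.1 hx
      exact T.mem_range c hc
    · rw [card_image_of_injOn T.injOn, Nat.card_Icc]
      exact le_of_eq (by simp [SkewShape.size])
  have hv : v ∈ A.cells.image T.entry := by
    rw [h, mem_Icc]
    exact ⟨h1, h2⟩
  simpa using hv

theorem descentSet_subset (T : SYT A) : T.descentSet ⊆ Ico 1 A.size :=
  filter_subset _ _

theorem row_le_of_forall_notMem_descentSet (T : SYT A) {c c' : ℕ × ℕ} (hc : c ∈ A.cells)
    (hc' : c' ∈ A.cells) (hle : T.entry c ≤ T.entry c')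
    (h : ∀ d ∈ T.descentSet, T.entry c ≤ d → T.entry c' ≤ d) : c'.1 ≤ c.1 := by
  obtain ⟨m, hm⟩ := Nat.exists_eq_add_of_le hle
  clear hle
  induction m generalizing c' with
  | zero => rw [T.injOn hc' hc hm]
  | succ m ih =>
    have h1 := mem_Icc.1 (T.mem_range c hc)
    have h2 := mem_Icc.1 (T.mem_range c' hc')
    obtain ⟨b, hb, hbe⟩ := T.exists_entry_eq (v := T.entry c + m) (by omega) (by omega)
    have hbc := ih hb (fun d hd hcd => by have := h d hd hcd; omega) hbe
    by_contra hlt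
    have := h (T.entry c + m) (mem_filter.2
      ⟨mem_Ico.2 (by omega), b, hb, c', hc', hbe, by omega, by omega⟩) (by omega)
    omega

theorem exists_descent_of_col_eq (T : SYT A) {c c' : ℕ × ℕ} (hc : c ∈ A.cells)
    (hc' : c' ∈ A.cells) (hcol : c.2 = c'.2) (hlt : T.entry c < T.entry c') :
    ∃ d ∈ T.descentSet, T.entry c ≤ d ∧ d < T.entry c' := by
  by_contra! h
  have hrow := T.row_le_of_forall_notMem_descentSet hc hc' hlt.le h
  obtain ⟨a, b⟩ := c
  obtain ⟨a', b'⟩ := c'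
  obtain rfl : b = b' := hcol
  rcases Nat.lt_or_eq_of_le hrow with h1 | h1
  · have := T.col_lt _ _ _ hc' hc h1
    omega
  · simp only at h1
    subst h1
    omega

theorem le_sum_min_card_col (T : SYT A) {N k : ℕ} (hN : N ≤ A.size)
    (h : ∀ v, 1 ≤ v → v ≤ N → #{d ∈ T.descentSet | d < v} < k) :
    N ≤ ∑ j ∈ A.cells.image Prod.snd, min k #{c ∈ A.cells | c.2 = j} := by
  have hcard : N ≤ #{c ∈ A.cells | T.entry c ≤ N} := by
    have : Icc 1 N ⊆ image T.entry {c ∈ A.cells | T.entry c ≤ N} := by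
      intro v hv
      rw [mem_Icc] at hv
      obtain ⟨c, hc, rfl⟩ := T.exists_entry_eq hv.1 (hv.2.trans hN)
      exact mem_image_of_mem _ (mem_filter.2 ⟨hc, hv.2⟩)
    simpa using (card_le_card this).trans card_image_le
  refine hcard.trans ?_
  rw [card_eq_sum_card_fiberwise (f := Prod.snd) (t := A.cells.image Prod.snd)
    (fun c hc => mem_coe.2 (mem_image_of_mem _ (mem_filter.1 (mem_coe.1 hc)).1))]
  refine sum_le_sum fun j _ => le_min ?_ ?_
  · rw [← card_range k]
    refine card_le_card_of_injOn (fun c => #{d ∈ T.descentSet | d < T.entry c}) ?_ ?_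
    · intro c hc
      simp only [coe_filter, mem_filter, Set.mem_ofPred_eq] at hc
      simp only [coe_range, Set.mem_Iio]
      exact h _ (mem_Icc.1 (T.mem_range c hc.1.1)).1 hc.1.2
    · have key : ∀ c ∈ A.cells, ∀ c' ∈ A.cells, c.2 = c'.2 → T.entry c < T.entry c' →
          #{d ∈ T.descentSet | d < T.entry c} < #{d ∈ T.descentSet | d < T.entry c'} := by
        intro c hc c' hc' hcol hlt
        obtain ⟨d, hd, hd1, hd2⟩ := T.exists_descent_of_col_eq hc hc' hcol hlt
        refine card_lt_card ⟨?_, ?_⟩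
        · intro x hx
          rw [mem_filter] at hx ⊢
          exact ⟨hx.1, hx.2.trans hlt⟩
        · intro hsub
          have := (mem_filter.1 (hsub (mem_filter.2 ⟨hd, hd2⟩))).2
          omega
      intro c hc c' hc' heq
      simp only [coe_filter, mem_filter, Set.mem_ofPred_eq] at hc hc' heq
      rcases lt_trichotomy (T.entry c) (T.entry c') with hlt | he | hlt
      · have := key c hc.1.1 c' hc'.1.1 (hc.2.trans hc'.2.symm) hlt
        omega
      · exact T.injOn hc.1.1 hc'.1.1 he
      · have := key c' hc'.1.1 c hc.1.1 (hc'.2.trans hc.2.symm) hlt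
        omega
  · refine card_le_card fun c hc => ?_
    simp only [mem_filter] at hc ⊢
    exact ⟨hc.1.1, hc.2⟩

/-- The tableau on the reflected shape obtained by transposing the filling. -/
def reflect (T : SYT A) (h : B.cells = A.cells.image Prod.swap) : SYT B where
  entry c := T.entry c.swap
  zero_off c hc := T.zero_off _ fun hc' => hc (by
    rw [h]
    exact mem_image.2 ⟨_, hc', c.swap_swap⟩)
  mem_range c hc := by
    have hs : B.size = A.size := by
      rw [SkewShape.size, h, card_image_of_injective _ Prod.swap_injective, SkewShape.size]
    rw [hs]
    rw [h] at hc
    obtain ⟨b, hb, rfl⟩ := mem_image.1 hc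
    simpa using T.mem_range b hb
  injOn := by
    rw [h, coe_image]
    rintro _ ⟨b, hb, rfl⟩ _ ⟨b', hb', rfl⟩ hbb
    rw [T.injOn hb hb' (by simpa using hbb)]
  row_lt i j j' hj hj' hlt := by
    rw [h] at hj hj'
    exact T.col_lt _ _ _ (by simpa using hj) (by simpa using hj') hlt
  col_lt i i' j hi hi' hlt := by
    rw [h] at hi hi'
    exact T.row_lt _ _ _ (by simpa using hi) (by simpa using hi') hlt

end SYT

namespace SkewShape

theorem mem_cells_iff (A : SkewShape) (c : ℕ × ℕ) :
    c ∈ A.cells ↔ A.mu.colLen c.2 ≤ c.1 ∧ c.1 < A.lam.colLen c.2 := by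
  obtain ⟨i, j⟩ := c
  rw [cells, mem_sdiff, YoungDiagram.mem_cells, YoungDiagram.mem_cells,
    YoungDiagram.mem_iff_lt_colLen, YoungDiagram.mem_iff_lt_colLen]
  simp only
  omega

theorem mem_cells_of_le_of_le {A : SkewShape} {a b a' b' i j : ℕ} (h : (a, b) ∈ A.cells)
    (h' : (a', b') ∈ A.cells) (hi : a ≤ i) (hi' : i ≤ a') (hj : b ≤ j) (hj' : j ≤ b') :
    (i, j) ∈ A.cells := by
  rw [mem_cells_iff] at *
  simp only at *
  have h1 := A.mu.colLen_anti _ _ hj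
  have h2 := A.lam.colLen_anti _ _ hj'
  omega

/-- The conjugate skew shape. -/
def transpose (A : SkewShape) : SkewShape where
  lam := A.lam.transpose
  mu := A.mu.transpose
  sub := YoungDiagram.transpose_mono A.sub

theorem cells_transpose (A : SkewShape) : A.transpose.cells = A.cells.image Prod.swap := by
  ext ⟨i, j⟩
  simp [cells, transpose, YoungDiagram.mem_transpose]

theorem cells_eq_image_transpose (A : SkewShape) :
    A.cells = A.transpose.cells.image Prod.swap := by
  rw [cells_transpose, image_image, Prod.swap_swap_eq, image_id]

theorem size_transpose (A : SkewShape) : A.transpose.size = A.size := by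
  rw [size, cells_transpose, card_image_of_injective _ Prod.swap_injective, size]

/-- The number of boxes of `A` strictly above `c` in its column. -/
def depth (A : SkewShape) (c : ℕ × ℕ) : ℕ := c.1 - A.mu.colLen c.2

/-- The reading order which lists the top boxes of all columns from left to right,
then the second boxes, and so on. -/
def key (A : SkewShape) (c : ℕ × ℕ) : ℕ ×ₗ ℕ := toLex (A.depth c, c.2)

theorem key_lt_iff {A : SkewShape} {c c' : ℕ × ℕ} :
    A.key c < A.key c' ↔ A.depth c < A.depth c' ∨ A.depth c = A.depth c' ∧ c.2 < c'.2 :=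
  Prod.Lex.toLex_lt_toLex

theorem key_injOn (A : SkewShape) : Set.InjOn A.key A.cells := by
  rintro ⟨a, b⟩ h ⟨a', b'⟩ h' heq
  rw [mem_coe, mem_cells_iff] at h h'
  have h1 := congrArg ofLex heq
  simp only [key, depth, ofLex_toLex, Prod.mk.injEq] at h1 h h' ⊢
  obtain ⟨h1, rfl⟩ := h1
  exact ⟨by omega, rfl⟩

theorem row_le_of_depth_eq {A : SkewShape} {c c' : ℕ × ℕ} (hc : c ∈ A.cells)
    (hc' : c' ∈ A.cells) (hd : A.depth c = A.depth c') (hlt : c.2 < c'.2) : c'.1 ≤ c.1 := by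
  rw [mem_cells_iff] at hc hc'
  have := A.mu.colLen_anti _ _ hlt.le
  unfold depth at hd
  omega

/-- The rank of the box `c` in the reading order `key`, and `0` off the shape. -/
def rank (A : SkewShape) (c : ℕ × ℕ) : ℕ :=
  if c ∈ A.cells then #{b ∈ A.cells | A.key b ≤ A.key c} else 0

theorem rank_lt_rank {A : SkewShape} {c c' : ℕ × ℕ} (hc : c ∈ A.cells) (hc' : c' ∈ A.cells)
    (h : A.key c < A.key c') : A.rank c < A.rank c' := by
  rw [rank, rank, if_pos hc, if_pos hc']
  refine card_lt_card ⟨?_, ?_⟩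
  · intro x hx
    rw [mem_filter] at hx ⊢
    exact ⟨hx.1, hx.2.trans h.le⟩
  · intro hsub
    exact (mem_filter.1 (hsub (mem_filter.2 ⟨hc', le_rfl⟩))).2.not_gt h

theorem key_lt_of_rank_lt {A : SkewShape} {c c' : ℕ × ℕ} (hc : c ∈ A.cells)
    (hc' : c' ∈ A.cells) (h : A.rank c < A.rank c') : A.key c < A.key c' := by
  rcases lt_trichotomy (A.key c) (A.key c') with hlt | heq | hlt
  · exact hlt
  · rw [A.key_injOn hc hc' heq] at h
    omega
  · have := rank_lt_rank hc' hc hlt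
    omega

/-- The standardization of the tableau whose columns read `1, 2, 3, …` downwards. -/
def colTableau (A : SkewShape) : SYT A where
  entry := A.rank
  zero_off c hc := if_neg hc
  mem_range c hc := by
    rw [rank, if_pos hc, mem_Icc]
    exact ⟨card_pos.2 ⟨c, mem_filter.2 ⟨hc, le_rfl⟩⟩, card_filter_le _ _⟩
  injOn := by
    intro c hc c' hc' h
    rcases lt_trichotomy (A.key c) (A.key c') with hlt | heq | hlt
    · have := rank_lt_rank hc hc' hlt
      omega
    · exact A.key_injOn hc hc' heq
    · have := rank_lt_rank hc' hc hlt
      omega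
  row_lt i j j' hj hj' hlt := by
    apply rank_lt_rank hj hj'
    rw [key_lt_iff]
    have := A.mu.colLen_anti _ _ hlt.le
    simp only [depth]
    omega
  col_lt i i' j hi hi' hlt := by
    apply rank_lt_rank hi hi'
    rw [key_lt_iff]
    rw [mem_cells_iff] at hi hi'
    simp only [depth] at *
    omega

theorem depth_le_of_rank_le {A : SkewShape} {c c' : ℕ × ℕ} (hc : c ∈ A.cells)
    (hc' : c' ∈ A.cells) (h : A.rank c ≤ A.rank c') : A.depth c ≤ A.depth c' := by
  by_contra hlt
  have := rank_lt_rank hc' hc (key_lt_iff.2 (Or.inl (by omega)))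
  omega

theorem card_descents_lt_le_depth {A : SkewShape} {c : ℕ × ℕ} (hc : c ∈ A.cells) :
    #{d ∈ A.colTableau.descentSet | d < A.rank c} ≤ A.depth c := by
  have hdesc : ∀ d ∈ A.colTableau.descentSet, ∃ b ∈ A.cells, A.rank b = d ∧
      ∀ b' ∈ A.cells, d < A.rank b' → A.depth b < A.depth b' := by
    intro d hd
    obtain ⟨-, b, hb, b₁, hb₁, hbd, hbd₁, hrow⟩ := mem_filter.1 hd
    change A.rank b = d at hbd
    change A.rank b₁ = d + 1 at hbd₁
    refine ⟨b, hb, hbd, fun b' hb' hlt => ?_⟩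
    refine lt_of_lt_of_le ?_ (depth_le_of_rank_le hb₁ hb' (by omega))
    rcases key_lt_iff.1 (key_lt_of_rank_lt hb hb₁ (by omega)) with h | ⟨h, h'⟩
    · exact h
    · have := row_le_of_depth_eq hb hb₁ h h'
      omega
  choose! f hf hrank hdepth using hdesc
  rw [← card_range (A.depth c)]
  refine card_le_card_of_injOn (fun d => A.depth (f d)) ?_ ?_
  · intro d hd
    obtain ⟨hd, hlt⟩ := mem_filter.1 (mem_coe.1 hd)
    exact mem_coe.2 (mem_range.2 (hdepth d hd c hc hlt))
  · intro d hd d' hd' heq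
    replace hd := (mem_filter.1 (mem_coe.1 hd)).1
    replace hd' := (mem_filter.1 (mem_coe.1 hd')).1
    simp only at heq
    have h1 := hdepth d hd (f d') (hf d' hd')
    have h2 := hdepth d' hd' (f d) (hf d hd)
    rw [hrank d' hd'] at h1
    rw [hrank d hd] at h2
    by_contra hne
    rcases Nat.lt_or_gt_of_ne hne with h | h
    · have := h1 h
      omega
    · have := h2 h
      omega

theorem depth_lt_of_rank_le {A : SkewShape} {c : ℕ × ℕ} {k : ℕ} (hc : c ∈ A.cells)
    (h : A.rank c ≤ #{b ∈ A.cells | A.depth b < k}) : A.depth c < k := by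
  by_contra hk
  have hlt : #{b ∈ A.cells | A.depth b < k} < A.rank c := by
    rw [rank, if_pos hc]
    refine card_lt_card ⟨?_, ?_⟩
    · intro b hb
      rw [mem_filter] at hb ⊢
      exact ⟨hb.1, (key_lt_iff.2 (Or.inl (by omega))).le⟩
    · intro hsub
      exact hk (mem_filter.1 (hsub (mem_filter.2 ⟨hc, le_rfl⟩))).2
  omega

theorem sum_min_card_col_le (A : SkewShape) (k : ℕ) :
    ∑ j ∈ A.cells.image Prod.snd, min k #{c ∈ A.cells | c.2 = j} ≤
      #{c ∈ A.cells | A.depth c < k} := by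
  rw [card_eq_sum_card_fiberwise (f := Prod.snd) (t := A.cells.image Prod.snd)
    (fun c hc => mem_coe.2 (mem_image_of_mem _ (mem_filter.1 (mem_coe.1 hc)).1))]
  refine sum_le_sum fun j _ => ?_
  have h1 : #{c ∈ A.cells | c.2 = j} ≤ #(Ico (A.mu.colLen j) (A.lam.colLen j)) := by
    refine card_le_card_of_injOn Prod.fst ?_ ?_
    · intro c hc
      simp only [coe_filter, Set.mem_ofPred_eq, mem_cells_iff] at hc
      obtain ⟨hc, rfl⟩ := hc
      exact mem_coe.2 (mem_Ico.2 hc)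
    · rintro ⟨a, b⟩ h ⟨a', b'⟩ h' heq
      simp_all
  have h2 : #(Ico (A.mu.colLen j) (min (A.lam.colLen j) (A.mu.colLen j + k))) ≤
      #{c ∈ {c ∈ A.cells | A.depth c < k} | c.2 = j} := by
    refine card_le_card_of_injOn (fun i => (i, j)) ?_ ?_
    · intro i hi
      rw [mem_coe, mem_Ico] at hi
      rw [mem_coe, mem_filter, mem_filter, mem_cells_iff]
      simp only [depth, and_true]
      omega
    · intro i _ i' _ h
      simpa using h
  rw [Nat.card_Ico] at h1 h2
  omega

end SkewShape

theorem SYT.descentSet_reflect {A B : SkewShape} (T : SYT A)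
    (h : B.cells = A.cells.image Prod.swap) :
    (T.reflect h).descentSet = Ico 1 A.size \ T.descentSet := by
  have hs : B.size = A.size := by
    rw [SkewShape.size, h, card_image_of_injective _ Prod.swap_injective, SkewShape.size]
  ext k
  simp only [descentSet, mem_filter, mem_sdiff, hs, not_and]
  refine and_congr_right fun hk => ?_
  obtain ⟨hk1, hk2⟩ := mem_Ico.1 hk
  obtain ⟨⟨a, b⟩, hc, hce⟩ := T.exists_entry_eq hk1 hk2.le
  obtain ⟨⟨a', b'⟩, hc', hce'⟩ := T.exists_entry_eq (v := k + 1) (by omega) (by omega)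
  have hT : (∃ c ∈ A.cells, ∃ c' ∈ A.cells, T.entry c = k ∧ T.entry c' = k + 1 ∧ c.1 < c'.1) ↔
      a < a' := by
    constructor
    · rintro ⟨x, hx, x', hx', hxe, hxe', hlt⟩
      rw [T.injOn hx hc (hxe.trans hce.symm), T.injOn hx' hc' (hxe'.trans hce'.symm)] at hlt
      exact hlt
    · exact fun hlt => ⟨_, hc, _, hc', hce, hce', hlt⟩
  have hR : (∃ c ∈ B.cells, ∃ c' ∈ B.cells, (T.reflect h).entry c = k ∧
      (T.reflect h).entry c' = k + 1 ∧ c.1 < c'.1) ↔ b < b' := by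
    rw [h]
    constructor
    · rintro ⟨y, hy, y', hy', hxe, hxe', hlt⟩
      obtain ⟨x, hx, rfl⟩ := mem_image.1 hy
      obtain ⟨x', hx', rfl⟩ := mem_image.1 hy'
      replace hxe : T.entry x = k := hxe
      replace hxe' : T.entry x' = k + 1 := hxe'
      rw [T.injOn hx hc (hxe.trans hce.symm), T.injOn hx' hc' (hxe'.trans hce'.symm)] at hlt
      exact hlt
    · exact fun hlt => ⟨_, mem_image_of_mem _ hc, _, mem_image_of_mem _ hc', hce, hce', hlt⟩
  rw [hR]
  simp only [hk, forall_const, hT]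
  constructor
  · intro hb ha
    have hm := SkewShape.mem_cells_of_le_of_le hc hc' le_rfl ha.le hb.le le_rfl
    have h1 := T.row_lt _ _ _ hc hm hb
    have h2 := T.col_lt _ _ _ hm hc' ha
    omega
  · intro ha
    by_contra hb
    rw [not_lt] at ha hb
    rcases hb.lt_or_eq with hb1 | rfl
    · have hm := SkewShape.mem_cells_of_le_of_le hc' hc le_rfl ha hb le_rfl
      have h1 := T.row_lt _ _ _ hc' hm hb1
      rcases ha.lt_or_eq with ha1 | rfl
      · have h2 := T.col_lt _ _ _ hm hc ha1
        omega
      · omega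
    · rcases ha.lt_or_eq with ha1 | rfl
      · have h2 := T.col_lt _ _ _ hc' hc ha1
        omega
      · omega

theorem size_eq_and_exists_descentSet_eq {A B : SkewShape} (h : Fsupp B ⊆ Fsupp A) :
    A.size = B.size ∧ ∀ T : SYT B, ∃ T' : SYT A, T'.descentSet = T.descentSet := by
  have key : ∀ T : SYT B, ∃ T' : SYT A, A.size = B.size ∧ T'.descentSet = T.descentSet := by
    intro T
    obtain ⟨T', hT'⟩ := h ⟨T, rfl⟩
    exact ⟨T', compOfSet_injective T'.descentSet_subset T.descentSet_subset hT'⟩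
  refine ⟨?_, fun T => ?_⟩
  · obtain ⟨_, hs, _⟩ := key B.colTableau
    exact hs
  · obtain ⟨T', _, hT'⟩ := key T
    exact ⟨T', hT'⟩

theorem dom_colsk_one {A B : SkewShape} (hs : A.size = B.size)
    (h : ∀ T : SYT B, ∃ T' : SYT A, T'.descentSet = T.descentSet) :
    Dom (colsk A.cells 1) (colsk B.cells 1) := by
  refine dom_of_sum_min_le ?_ fun k => ?_
  · rw [sum_colsk_one, sum_colsk_one]
    exact hs
  rw [sum_map_colsk_one _ (Nat.min_zero k), sum_map_colsk_one _ (Nat.min_zero k)]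
  refine (B.sum_min_card_col_le k).trans ?_
  obtain ⟨T', hT'⟩ := h B.colTableau
  have hN : #{c ∈ B.cells | B.depth c < k} ≤ B.size := card_filter_le _ _
  refine T'.le_sum_min_card_col (hN.trans hs.ge) fun v hv1 hv2 => ?_
  obtain ⟨c, hc, rfl⟩ := B.colTableau.exists_entry_eq hv1 (hv2.trans hN)
  rw [hT']
  exact (SkewShape.card_descents_lt_le_depth hc).trans_lt (SkewShape.depth_lt_of_rank_le hc hv2)

theorem stmt9 (A B : SkewShape) (h : Fsupp B ⊆ Fsupp A) :
    Dom (rowsk A.cells 1) (rowsk B.cells 1) ∧ Dom (colsk A.cells 1) (colsk B.cells 1) := by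
  obtain ⟨hs, hT⟩ := size_eq_and_exists_descentSet_eq h
  refine ⟨?_, dom_colsk_one hs hT⟩
  rw [rowsk_eq_colsk_of_swap A.cells_transpose, rowsk_eq_colsk_of_swap B.cells_transpose]
  refine dom_colsk_one (by rw [A.size_transpose, B.size_transpose, hs]) fun T => ?_
  obtain ⟨T', hT'⟩ := hT (T.reflect B.cells_eq_image_transpose)
  refine ⟨T'.reflect A.cells_transpose, ?_⟩
  rw [SYT.descentSet_reflect, hT', SYT.descentSet_reflect, B.size_transpose, hs,
    Finset.sdiff_sdiff_eq_self]
  exact B.size_transpose ▸ T.descentSet_subset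

end SkewPaper
end

section
/- For any skew shape A and any ℓ ≥ 2, cols_{ℓ−1}(trim(A)) = cols_ℓ(A). -/
namespace SkewPaper

open Finset

theorem mem_colRows {s : Finset (ℕ × ℕ)} {i j : ℕ} : i ∈ colRows s j ↔ (i, j) ∈ s := by
  simp [colRows]

theorem mem_trimCells_succ {s : Finset (ℕ × ℕ)} {i j : ℕ} :
    (i, j + 1) ∈ trimCells s ↔ (i, j + 1) ∈ s ∧ (i, j) ∈ s := by
  simp [trimCells]

theorem overlapCol_trimCells_zero (s : Finset (ℕ × ℕ)) (k : ℕ) :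
    overlapCol (trimCells s) k 0 = 0 := by
  have h : colRows (trimCells s) 0 = ∅ := by
    ext i
    simp [mem_colRows, trimCells]
  simp [overlapCol, h]

theorem overlapCol_trimCells_succ (s : Finset (ℕ × ℕ)) (k j : ℕ) (hk : 1 ≤ k) :
    overlapCol (trimCells s) k (j + 1) = overlapCol s (k + 1) j := by
  unfold overlapCol
  congr 1
  ext i
  simp only [mem_filter, mem_colRows, Nat.add_right_comm j 1, mem_trimCells_succ]
  constructor
  · rintro ⟨⟨-, h0⟩, h⟩
    refine ⟨h0, fun t ht => ?_⟩
    cases t with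
    | zero => exact h0
    | succ t => exact (h t (by omega)).1
  · rintro ⟨h0, h⟩
    exact ⟨⟨h 1 (by omega), h0⟩, fun t ht => ⟨h (t + 1) (by omega), h t (by omega)⟩⟩

theorem mem_image_snd_of_overlapCol_pos {s : Finset (ℕ × ℕ)} {k j : ℕ}
    (h : 0 < overlapCol s k j) : j ∈ s.image Prod.snd := by
  obtain ⟨i, hi⟩ := card_pos.mp h
  exact mem_image_of_mem Prod.snd (mem_colRows.mp (mem_filter.mp hi).1)

theorem colsk_eq_map_filter (s : Finset (ℕ × ℕ)) (k : ℕ) :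
    colsk s k =
      ((s.image Prod.snd).filter (fun j => 0 < overlapCol s k j)).val.map (overlapCol s k) := by
  rw [colsk, Multiset.filter_map, filter_val]
  rfl

theorem colsk_trimCells (s : Finset (ℕ × ℕ)) (k : ℕ) (hk : 1 ≤ k) :
    colsk (trimCells s) k = colsk s (k + 1) := by
  have h : ((trimCells s).image Prod.snd).filter (fun j => 0 < overlapCol (trimCells s) k j) =
      ((s.image Prod.snd).filter (fun j => 0 < overlapCol s (k + 1) j)).map
        (addRightEmbedding 1) := by
    ext j
    simp only [mem_filter, mem_map, addRightEmbedding_apply]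
    constructor
    · rintro ⟨-, hj⟩
      cases j with
      | zero => simp [overlapCol_trimCells_zero] at hj
      | succ j =>
        rw [overlapCol_trimCells_succ s k j hk] at hj
        exact ⟨j, ⟨mem_image_snd_of_overlapCol_pos hj, hj⟩, rfl⟩
    · rintro ⟨j, ⟨-, hj⟩, rfl⟩
      rw [← overlapCol_trimCells_succ s k j hk] at hj
      exact ⟨mem_image_snd_of_overlapCol_pos hj, hj⟩
  rw [colsk_eq_map_filter, colsk_eq_map_filter, h, map_val, Multiset.map_map]
  exact Multiset.map_congr rfl fun j _ => overlapCol_trimCells_succ s k j hk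

theorem stmt10 (A : SkewShape) (l : ℕ) (hl : 2 ≤ l) :
    colsk (trimCells A.cells) (l - 1) = colsk A.cells l := by
  obtain ⟨k, rfl⟩ := Nat.exists_eq_add_of_le' (Nat.le_of_succ_le hl)
  exact colsk_trimCells A.cells k (by omega)

end SkewPaper
end

section
/- Let A and B be elongated ribbons with |A| = |B|. Then Fsupp(A) ⊇ Fsupp(B) if and only if rows_k(A) ⊴ rows_k(B) for all k ≥ 1. -/
namespace SkewPaper

open Finset

/-- The number of positions below `n` at which the word `f` has the letter `i`. -/
def letterCount (n : ℕ) (f : ℕ → ℕ) (i : ℕ) : ℕ :=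
  ((range n).filter (fun p => f p = i)).card

/-- A word of length `n` in the letters `0, …, r-1` whose strict ascents are prescribed by `D`
and in which, for each `i`, some letter `i` precedes some letter `i + 1`. -/
structure IsLinkedWord (n r : ℕ) (D : ℕ → Prop) (f : ℕ → ℕ) : Prop where
  lt : ∀ p < n, f p < r
  asc : ∀ p, p + 1 < n → (f p < f (p + 1) ↔ D p)
  link : ∀ i, i + 1 < r → ∃ p q, p < q ∧ q < n ∧ f p = i ∧ f q = i + 1

lemma letterCount_update {n : ℕ} (f : ℕ → ℕ) {q : ℕ} (hq : q < n) (v j : ℕ) :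
    letterCount n (Function.update f q v) j + (if f q = j then 1 else 0) =
      letterCount n f j + (if v = j then 1 else 0) := by
  unfold letterCount
  rw [card_filter, card_filter, ← add_sum_erase _ _ (mem_range.2 hq),
    ← add_sum_erase (range n) (fun p => if f p = j then 1 else 0) (mem_range.2 hq)]
  have : ∑ x ∈ (range n).erase q, (if Function.update f q v x = j then 1 else 0) =
      ∑ x ∈ (range n).erase q, (if f x = j then 1 else 0) := by
    refine sum_congr rfl fun x hx => ?_
    rw [Function.update_of_ne (ne_of_mem_erase hx)]
  rw [this]
  simp only [Function.update_self]
  omega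

lemma exists_two_other_positions {n : ℕ} {f : ℕ → ℕ} {i : ℕ} (h : 3 ≤ letterCount n f i) (q : ℕ) :
    ∃ p p', p < p' ∧ p' < n ∧ p ≠ q ∧ p' ≠ q ∧ f p = i ∧ f p' = i := by
  have h2 : 1 < (((range n).filter (fun p => f p = i)).erase q).card := by
    have := pred_card_le_card_erase (s := (range n).filter (fun p => f p = i)) (a := q)
    unfold letterCount at h
    omega
  obtain ⟨a, ha, b, hb, hab⟩ := one_lt_card.1 h2
  simp only [mem_erase, mem_filter, mem_range] at ha hb
  rcases lt_or_gt_of_ne hab with h | h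
  · exact ⟨a, b, h, hb.2.1, ha.1, hb.1, ha.2.2, hb.2.2⟩
  · exact ⟨b, a, h, ha.2.1, hb.1, ha.1, hb.2.2, ha.2.2⟩

lemma exists_other_position {n : ℕ} {f : ℕ → ℕ} {i : ℕ} (h : 2 ≤ letterCount n f i) (q : ℕ) :
    ∃ p, p < n ∧ p ≠ q ∧ f p = i := by
  obtain ⟨b, hb, hbq⟩ := exists_mem_ne (s := (range n).filter (fun p => f p = i)) h q
  simp only [mem_filter, mem_range] at hb
  exact ⟨b, hb.1, hbq, hb.2⟩

/-- An occurrence of `i` that can be raised to `i + 1` without changing the ascents of `f`. -/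
def Raisable (n : ℕ) (f : ℕ → ℕ) (i q : ℕ) : Prop :=
  q < n ∧ f q = i ∧ (∀ p, p + 1 = q → f p ≠ i) ∧ (q + 1 < n → f (q + 1) ≠ i + 1)

lemma followed_of_not_raisable {n N : ℕ} {f : ℕ → ℕ} {i : ℕ} (hN : N ≤ n)
    (h : ∀ q < N, ¬ Raisable n f i q) :
    ∀ p < N, f p = i → p + 1 < n ∧ f (p + 1) = i + 1 := by
  intro p
  induction p with
  | zero =>
    intro hp hpi
    have := h 0 hp
    unfold Raisable at this
    grind
  | succ p ih =>
    intro hp hpi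
    have := h (p + 1) hp
    unfold Raisable at this
    grind

/-- The number of positions at which the letter `i` is immediately followed by `i + 1`. -/
def adjacentCount (n : ℕ) (f : ℕ → ℕ) (i : ℕ) : ℕ :=
  ((range n).filter (fun p => p + 1 < n ∧ f p = i ∧ f (p + 1) = i + 1)).card

lemma adjacentCount_le (n : ℕ) (f : ℕ → ℕ) (i : ℕ) :
    adjacentCount n f i ≤ letterCount n f (i + 1) := by
  refine card_le_card_of_injOn (fun p => p + 1) ?_ (fun a _ b _ h => by simpa using h)
  intro p hp
  simp only [coe_filter, mem_range, Set.mem_ofPred_eq] at hp ⊢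
  exact ⟨hp.2.1, hp.2.2.2⟩

lemma exists_raisable {n : ℕ} {f : ℕ → ℕ} {i : ℕ}
    (hlt : adjacentCount n f i < letterCount n f i) : ∃ q, Raisable n f i q := by
  by_contra! hno
  have key := followed_of_not_raisable (le_refl n) (fun q _ => hno q)
  refine absurd hlt (not_lt.2 (card_le_card fun p hp => ?_))
  simp only [mem_filter, mem_range] at hp ⊢
  exact ⟨hp.1, (key p hp.1 hp.2).1, hp.2, (key p hp.1 hp.2).2⟩

lemma adjacentCount_raise {n : ℕ} {f : ℕ → ℕ} {i q : ℕ} (hq : Raisable n f i q) :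
    adjacentCount n (Function.update f q (i + 1)) i ≤ adjacentCount n f i := by
  refine card_le_card fun p hp => ?_
  simp only [mem_filter, mem_range, Function.update_apply] at hp ⊢
  have := hq.2.2.1 p
  grind

namespace IsLinkedWord

variable {n r : ℕ} {D : ℕ → Prop} {f : ℕ → ℕ}

lemma raise (hf : IsLinkedWord n r D f) {i q : ℕ} (hi : i + 1 < r) (hq : Raisable n f i q)
    (h1 : ∃ p z, p < z ∧ z < n ∧ p ≠ q ∧ f p = i ∧ f z = i + 1)
    (h0 : ∀ k, k + 1 = i → ∃ p z, p < z ∧ z < n ∧ z ≠ q ∧ f p = k ∧ f z = i) :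
    IsLinkedWord n r D (Function.update f q (i + 1)) := by
  obtain ⟨hqn, hqi, hq1, hq2⟩ := hq
  refine ⟨fun p hp => ?_, fun p hp => ?_, fun j hj => ?_⟩
  · have := hf.lt p hp
    rw [Function.update_apply]; split_ifs <;> omega
  · have h := hf.asc p hp
    have ha := hq1 p
    rw [← h, Function.update_apply, Function.update_apply]
    grind
  · by_cases hji : j = i
    · obtain ⟨p, z, hpz, hz, hpq, hpi, hzi⟩ := h1
      refine ⟨p, z, hpz, hz, ?_, ?_⟩ <;> rw [Function.update_apply] <;> grind
    by_cases hji' : j + 1 = i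
    · obtain ⟨p, z, hpz, hz, hpq, hpi, hzi⟩ := h0 j hji'
      refine ⟨p, z, hpz, hz, ?_, ?_⟩ <;> rw [Function.update_apply] <;> grind
    · obtain ⟨p, z, hpz, hz, hpi, hzi⟩ := hf.link j hj
      refine ⟨p, z, hpz, hz, ?_, ?_⟩ <;> rw [Function.update_apply] <;> grind

/-- The exceptional case of `exists_transfer`: the rightmost `i` cannot be raised without
unlinking `i - 1` from `i`, so an earlier `i` is exchanged with the first `i - 1`. -/
lemma rotate (hf : IsLinkedWord n r D f) (h2 : ∀ j < r, 2 ≤ letterCount n f j) {k p p' s q : ℕ}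
    (hi : k + 2 < r) (hq : Raisable n f (k + 1) q) (hpp : p < p') (hps : p' < s) (hsq : s < q)
    (hp : f p = k + 1) (hp1 : f (p + 1) = k + 2) (hp' : f p' = k + 1) (hp1' : f (p' + 1) = k + 2)
    (hs : f s = k) (hsmin : ∀ t < s, f t ≠ k) (hs1 : f (s + 1) = k + 1 → s + 1 = q) :
    IsLinkedWord n r D
      (Function.update (Function.update (Function.update f p k) s (k + 1)) q (k + 2)) := by
  obtain ⟨hqn, hqi, hq1, hq2⟩ := hq
  have hval : ∀ t, Function.update (Function.update (Function.update f p k) s (k + 1)) q (k + 2) t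
      = if t = q then k + 2 else if t = s then k + 1 else if t = p then k else f t := by
    intro t
    simp only [Function.update_apply]
  refine ⟨fun t ht => ?_, fun t ht => ?_, fun j hj => ?_⟩
  · have := hf.lt t ht
    rw [hval]; split_ifs <;> omega
  · have h := hf.asc t ht
    have ha := hq1 t
    have hb := hsmin t
    have hc := hsmin (t + 1)
    clear hsmin hq1
    rw [← h, hval, hval]
    clear hval h2 hf
    grind (splits := 20)
  · by_cases hj1 : j = k + 1
    · exact ⟨p', p' + 1, by omega, by omega, by rw [hval]; grind, by rw [hval]; grind⟩
    by_cases hj2 : j = k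
    · exact ⟨p, s, by omega, by omega, by rw [hval]; grind, by rw [hval]; grind⟩
    obtain ⟨a, z, haz, hz, ha, hz'⟩ := hf.link j hj
    by_cases hj3 : j + 1 = k
    · obtain ⟨y, hy, hys, hyk⟩ := exists_other_position (h2 k (by omega)) s
      have := hsmin y
      have := hsmin z
      by_cases hzs : z = s
      · exact ⟨a, y, by grind, by omega, by rw [hval]; grind, by rw [hval]; grind⟩
      · exact ⟨a, z, by omega, by omega, by rw [hval]; grind, by rw [hval]; grind⟩
    · exact ⟨a, z, haz, hz, by rw [hval]; grind, by rw [hval]; grind⟩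

lemma adjacentCount_rotate {k p s q : ℕ} (hq : Raisable n f (k + 1) q)
    (hps : p < s) (hsq : s < q) (hp : f p = k + 1) (hp1 : f (p + 1) = k + 2) :
    adjacentCount n
      (Function.update (Function.update (Function.update f p k) s (k + 1)) q (k + 2)) (k + 1) ≤
      adjacentCount n f (k + 1) := by
  have hqn := hq.1
  have hq1 := hq.2.2.1
  refine card_le_card_of_injOn (fun t => if t = s then p else t) ?_ ?_
  · intro t ht
    have := hq1 t
    simp only [coe_filter, mem_range, Set.mem_ofPred_eq, Function.update_apply] at ht ⊢
    grind
  · intro t ht t' ht' h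
    simp only [coe_filter, mem_range, Set.mem_ofPred_eq, Function.update_apply] at ht ht'
    have hne : ∀ x, (if x = q then k + 2 else if x = s then k + 1 else if x = p then k else f x)
        = k + 1 → x ≠ p := by
      rintro x hx rfl
      rw [if_neg (by omega), if_neg (by omega), if_pos rfl] at hx
      omega
    have e1 := hne t ht.2.2.1
    have e2 := hne t' ht'.2.2.1
    clear ht ht' hne
    simp only at h
    split_ifs at h <;> omega

lemma exists_transfer (hf : IsLinkedWord n r D f) (h2 : ∀ j < r, 2 ≤ letterCount n f j) {i : ℕ}
    (hi : i + 1 < r) (h3 : 3 ≤ letterCount n f i)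
    (hlt : adjacentCount n f i < letterCount n f i) :
    ∃ g, IsLinkedWord n r D g ∧ adjacentCount n g i ≤ adjacentCount n f i ∧
      ∀ j, letterCount n g j + (if j = i then 1 else 0) =
      letterCount n f j + (if j = i + 1 then 1 else 0) := by
  have hraise : ∀ q, Raisable n f i q → ∀ j,
      letterCount n (Function.update f q (i + 1)) j + (if j = i then 1 else 0) =
      letterCount n f j + (if j = i + 1 then 1 else 0) := by
    intro q hq j
    have := letterCount_update f hq.1 (i + 1) j
    rw [hq.2.1] at this
    simpa only [eq_comm] using this
  classical
  have hex := exists_raisable hlt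
  obtain ⟨hq, hmin⟩ : Raisable n f i (Nat.find hex) ∧ ∀ p < Nat.find hex, ¬ Raisable n f i p :=
    ⟨Nat.find_spec hex, fun p hp => Nat.find_min hex hp⟩
  generalize Nat.find hex = q at hq hmin
  have hfol := followed_of_not_raisable hq.1.le hmin
  by_cases hfirst : ∃ p < q, f p = i
  · obtain ⟨p, hpq, hpi⟩ := hfirst
    have h1 : ∃ p z, p < z ∧ z < n ∧ p ≠ q ∧ f p = i ∧ f z = i + 1 :=
      ⟨p, p + 1, by omega, (hfol p hpq hpi).1, by omega, hpi, (hfol p hpq hpi).2⟩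
    by_cases h0 : ∀ k, k + 1 = i → ∃ p z, p < z ∧ z < n ∧ z ≠ q ∧ f p = k ∧ f z = i
    · exact ⟨_, hf.raise hi hq h1 h0, adjacentCount_raise hq, hraise q hq⟩
    push Not at h0
    obtain ⟨k, rfl, hk⟩ := h0
    have hexk : ∃ s, f s = k ∧ s < q := by
      obtain ⟨a, z, haz, hz, ha, hz'⟩ := hf.link k (by omega)
      have : z = q := by
        by_contra hzq
        exact hk a z haz hz hzq ha hz'
      exact ⟨a, ha, this ▸ haz⟩
    obtain ⟨⟨hs, hsq⟩, hsmin⟩ : (f (Nat.find hexk) = k ∧ Nat.find hexk < q) ∧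
        ∀ t < Nat.find hexk, ¬ (f t = k ∧ t < q) :=
      ⟨Nat.find_spec hexk, fun t ht => Nat.find_min hexk ht⟩
    generalize Nat.find hexk = s at hs hsq hsmin
    obtain ⟨a, b, hab, hb, haq, hbq, ha, hb'⟩ := exists_two_other_positions h3 q
    have hbs : b < s := by
      by_contra hbs
      refine hk s b ?_ hb hbq hs hb'
      rcases eq_or_ne b s with rfl | h
      · omega
      · omega
    have hfa := hfol a (by omega) ha
    have hfb := hfol b (by omega) hb'
    refine ⟨_, hf.rotate h2 hi hq hab hbs hsq ha hfa.2 hb' hfb.2 hs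
      (fun t ht h => hsmin t ht ⟨h, by omega⟩) (fun h => ?_),
      adjacentCount_rotate hq (hab.trans hbs) hsq ha hfa.2, fun j => ?_⟩
    · by_contra hne
      exact hk s (s + 1) (by omega) (by have := hq.1; omega) hne hs h
    have e1 := letterCount_update f (show a < n by omega) k j
    have e2 := letterCount_update (Function.update f a k) (show s < n by have := hq.1; omega)
      (k + 1) j
    have e3 := letterCount_update (Function.update (Function.update f a k) s (k + 1)) hq.1
      (k + 2) j
    rw [Function.update_of_ne (by omega), hs] at e2
    rw [Function.update_of_ne (by omega), Function.update_of_ne (by omega), hq.2.1] at e3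
    rw [ha] at e1
    have c1 : (j = k + 1) = (k + 1 = j) := propext eq_comm
    have c2 : (j = k + 1 + 1) = (k + 2 = j) := propext eq_comm
    simp only [c1, c2]
    omega
  · push Not at hfirst
    obtain ⟨a, b, hab, hb, haq, hbq, ha, hb'⟩ := exists_two_other_positions h3 q
    have hqa : q < a := by
      by_contra h
      exact hfirst a (by omega) ha
    by_cases h1 : ∃ p z, p < z ∧ z < n ∧ p ≠ q ∧ f p = i ∧ f z = i + 1
    · refine ⟨_, hf.raise hi hq h1 fun k hk => ?_, adjacentCount_raise hq, hraise q hq⟩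
      obtain ⟨p, z, hpz, hz, hp, hz'⟩ := hf.link k (by omega)
      have := hfirst z
      exact ⟨p, max z b, by omega, by omega, by omega, hp, by grind⟩
    push Not at h1
    have hexc : ∃ c, q < c ∧ f c = i := ⟨a, hqa, ha⟩
    obtain ⟨⟨hqc, hc⟩, hcmin⟩ : (q < Nat.find hexc ∧ f (Nat.find hexc) = i) ∧
        ∀ t < Nat.find hexc, ¬ (q < t ∧ f t = i) :=
      ⟨Nat.find_spec hexc, fun t ht => Nat.find_min hexc ht⟩
    have hca : Nat.find hexc ≤ a := Nat.find_min' hexc ⟨hqa, ha⟩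
    generalize Nat.find hexc = c at hqc hc hcmin hca
    obtain ⟨p, z, hpz, hz, hp, hz'⟩ := hf.link i hi
    have hpq : p = q := by
      by_contra h
      exact h1 p z hpz hz h hp hz'
    subst hpq
    have hzc : z < c := by
      by_contra h
      have : z ≠ c := by rintro rfl; omega
      exact h1 c z (by omega) hz (by omega) hc hz'
    have hcr : Raisable n f i c := by
      refine ⟨by omega, hc, fun t ht h => ?_, fun h h' => ?_⟩
      · rcases lt_trichotomy t p with h' | rfl | h'
        · exact hfirst t h' h
        · omega
        · exact hcmin t (by omega) ⟨h', h⟩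
      · exact h1 c (c + 1) (by omega) h (by omega) hc h'
    refine ⟨_, hf.raise hi hcr ⟨p, z, hpz, hz, by omega, hp, hz'⟩ fun k hk => ?_,
      adjacentCount_raise hcr, hraise c hcr⟩
    obtain ⟨x, y, hxy, hy, hx, hy'⟩ := hf.link k (by omega)
    rcases eq_or_ne y c with rfl | hyc
    · exact ⟨x, b, by omega, by omega, by omega, hx, by omega⟩
    · exact ⟨x, y, hxy, hy, hyc, hx, by omega⟩

lemma exists_shift (hf : IsLinkedWord n r D f) (h2 : ∀ j < r, 2 ≤ letterCount n f j) {i : ℕ}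
    (hi : i + 1 < r) (m : ℕ) (hm : letterCount n f (i + 1) + m ≤ letterCount n f i) :
    ∃ g, IsLinkedWord n r D g ∧ adjacentCount n g i ≤ letterCount n f (i + 1) ∧
      ∀ j, letterCount n g j + (if j = i then m else 0) =
        letterCount n f j + (if j = i + 1 then m else 0) := by
  induction m with
  | zero => exact ⟨f, hf, adjacentCount_le n f i, fun j => by simp⟩
  | succ m ih =>
    obtain ⟨g, hg, hga, hgc⟩ := ih (by omega)
    have hgi := hgc i
    have hfi := h2 (i + 1) hi
    rw [if_pos rfl, if_neg (by omega)] at hgi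
    obtain ⟨g', hg', hga', hgc'⟩ := hg.exists_transfer (i := i) (fun j hj => by
      have h1 := hgc j
      have h2 := h2 j hj
      split_ifs at h1 <;> subst_vars <;> omega) hi (by omega) (by omega)
    refine ⟨g', hg', hga'.trans hga, fun j => ?_⟩
    have h1 := hgc j
    have h2 := hgc' j
    split_ifs at h1 h2 ⊢ <;> omega

end IsLinkedWord

/-- The content `γ` is attained by a linked word with ascents `D`. -/
def Realizable (n r : ℕ) (D : ℕ → Prop) (γ : Fin r → ℕ) : Prop :=
  ∃ f, IsLinkedWord n r D f ∧ ∀ i : Fin r, letterCount n f i = γ i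

lemma IsLinkedWord.reverse {n r : ℕ} {D : ℕ → Prop} {f : ℕ → ℕ} (hf : IsLinkedWord n r D f) :
    IsLinkedWord n r (fun p => D (n - 2 - p)) (fun p => r - 1 - f (n - 1 - p)) := by
  refine ⟨fun p hp => ?_, fun p hp => ?_, fun i hi => ?_⟩
  · have := hf.lt (n - 1 - p) (by omega)
    omega
  · have h := hf.asc (n - 2 - p) (by omega)
    have h1 := hf.lt (n - 1 - p) (by omega)
    have h2 := hf.lt (n - 2 - p) (by omega)
    rw [show n - 2 - p + 1 = n - 1 - p by omega] at h
    rw [← h, show n - 1 - (p + 1) = n - 2 - p by omega]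
    omega
  · obtain ⟨p, q, hpq, hq, hp, hq'⟩ := hf.link (r - 2 - i) (by omega)
    refine ⟨n - 1 - q, n - 1 - p, by omega, by omega, ?_, ?_⟩
    · rw [show n - 1 - (n - 1 - q) = q by omega]; omega
    · rw [show n - 1 - (n - 1 - p) = p by omega]; omega

lemma letterCount_reverse {n r : ℕ} {f : ℕ → ℕ} (hf : ∀ p < n, f p < r) {i : ℕ} (hi : i < r) :
    letterCount n (fun p => r - 1 - f (n - 1 - p)) i = letterCount n f (r - 1 - i) := by
  refine card_nbij' (fun p => n - 1 - p) (fun p => n - 1 - p) ?_ ?_ ?_ ?_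
  · intro p hp
    simp only [coe_filter, mem_range, Set.mem_ofPred_eq] at hp ⊢
    have := hf (n - 1 - p) (by omega)
    omega
  · intro p hp
    simp only [coe_filter, mem_range, Set.mem_ofPred_eq] at hp ⊢
    rw [show n - 1 - (n - 1 - p) = p by omega]
    omega
  · intro p hp
    simp only [coe_filter, mem_range, Set.mem_ofPred_eq] at hp
    show n - 1 - (n - 1 - p) = p
    omega
  · intro p hp
    simp only [coe_filter, mem_range, Set.mem_ofPred_eq] at hp
    show n - 1 - (n - 1 - p) = p
    omega

namespace Realizable

variable {n r : ℕ} {D : ℕ → Prop} {γ γ' : Fin r → ℕ}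

lemma congr_ascents {D' : ℕ → Prop} (h : Realizable n r D γ)
    (hD : ∀ p, p + 1 < n → (D p ↔ D' p)) : Realizable n r D' γ := by
  obtain ⟨f, hf, hc⟩ := h
  exact ⟨f, ⟨hf.lt, fun p hp => (hf.asc p hp).trans (hD p hp), hf.link⟩, hc⟩

lemma reverse (h : Realizable n r D γ) :
    Realizable n r (fun p => D (n - 2 - p)) (fun i => γ i.rev) := by
  obtain ⟨f, hf, hc⟩ := h
  refine ⟨_, hf.reverse, fun i => ?_⟩
  show _ = γ i.rev
  rw [letterCount_reverse hf.lt i.2, ← hc, Fin.val_rev]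
  congr 1
  omega

lemma shift_right (h : Realizable n r D γ) (h2 : ∀ i, 2 ≤ γ i) {a b : Fin r}
    (hab : (a : ℕ) + 1 = b) (m : ℕ) (hm : γ b + m ≤ γ a)
    (hγ' : ∀ j, γ' j + (if j = a then m else 0) = γ j + (if j = b then m else 0)) :
    Realizable n r D γ' := by
  obtain ⟨f, hf, hc⟩ := h
  obtain ⟨g, hg, -, hgc⟩ := hf.exists_shift (i := a) (fun j hj => by
    have := h2 ⟨j, hj⟩
    rwa [← hc] at this) (by omega) m (by rw [hab, hc, hc]; exact hm)
  refine ⟨g, hg, fun j => ?_⟩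
  have h1 := hgc j
  have h2 := hγ' j
  rw [hc] at h1
  simp only [hab, ← Fin.ext_iff] at h1
  omega

lemma shift_left (h : Realizable n r D γ) (h2 : ∀ i, 2 ≤ γ i) {a b : Fin r}
    (hab : (b : ℕ) + 1 = a) (m : ℕ) (hm : γ b + m ≤ γ a)
    (hγ' : ∀ j, γ' j + (if j = a then m else 0) = γ j + (if j = b then m else 0)) :
    Realizable n r D γ' := by
  have := (h.reverse.shift_right (a := a.rev) (b := b.rev) (γ' := fun i => γ' i.rev)
    (fun i => h2 _) (by simp only [Fin.val_rev]; omega) m (by simpa using hm) (fun j => by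
      simpa [Fin.rev_eq_iff] using hγ' j.rev)).reverse
  simp only [Fin.rev_rev] at this
  refine this.congr_ascents fun p hp => ?_
  rw [show n - 2 - (n - 2 - p) = p by omega]

lemma swap_adjacent (h : Realizable n r D γ) (h2 : ∀ i, 2 ≤ γ i) {a b : Fin r}
    (hab : (a : ℕ) + 1 = b) : Realizable n r D (γ ∘ Equiv.swap a b) := by
  have hne : a ≠ b := by rintro rfl; omega
  rcases le_total (γ b) (γ a) with hle | hle
  · refine h.shift_right h2 hab (γ a - γ b) (by omega) fun j => ?_
    simp only [Function.comp, Equiv.swap_apply_def]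
    split_ifs <;> subst_vars <;> omega
  · refine h.shift_left h2 hab (γ b - γ a) (by omega) fun j => ?_
    simp only [Function.comp, Equiv.swap_apply_def]
    split_ifs <;> subst_vars <;> omega

lemma perm (h : Realizable n r D γ) (h2 : ∀ i, 2 ≤ γ i) (σ : Equiv.Perm (Fin r)) :
    Realizable n r D (γ ∘ σ) := by
  obtain _ | r := r
  · rwa [Subsingleton.elim (γ ∘ σ) γ]
  have hσ : σ ∈ Submonoid.closure
      (Set.range fun i : Fin r => Equiv.swap i.castSucc i.succ) := by
    rw [Equiv.Perm.mclosure_swap_castSucc_succ]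
    trivial
  induction hσ using Submonoid.closure_induction_right with
  | one => exact h
  | mul_right σ _ τ hτ ih =>
    obtain ⟨i, rfl⟩ := hτ
    exact ih.swap_adjacent (fun i => h2 _) (by simp)

end Realizable

/-- The sum of the values of `γ` at the indices below `k`. -/
def prefixSum {r : ℕ} (γ : Fin r → ℕ) (k : ℕ) : ℕ :=
  ∑ i : Fin r, if (i : ℕ) < k then γ i else 0

lemma prefixSum_zero {r : ℕ} (γ : Fin r → ℕ) : prefixSum γ 0 = 0 := by
  simp [prefixSum]

lemma prefixSum_of_le {r : ℕ} (γ : Fin r → ℕ) {k : ℕ} (hk : r ≤ k) : prefixSum γ k = ∑ i, γ i :=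
  sum_congr rfl fun i _ => if_pos (i.2.trans_le hk)

lemma prefixSum_succ {r : ℕ} (γ : Fin r → ℕ) (a : Fin r) :
    prefixSum γ (a + 1) = prefixSum γ a + γ a := by
  have : γ a = ∑ i, if i = a then γ i else 0 := by simp
  rw [this]
  unfold prefixSum
  rw [← sum_add_distrib]
  refine sum_congr rfl fun i _ => ?_
  have : i = a ↔ (i : ℕ) = a := Fin.ext_iff
  split_ifs <;> omega

lemma prefixSum_transfer {r : ℕ} {γ γ' : Fin r → ℕ} {a b : Fin r} (hab : (a : ℕ) + 1 = b)
    (hγ' : ∀ j, γ' j + (if j = a then 1 else 0) = γ j + (if j = b then 1 else 0)) (k : ℕ) :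
    prefixSum γ' k + (if k = a + 1 then 1 else 0) = prefixSum γ k := by
  have h : prefixSum γ' k + (∑ i : Fin r, if i = a then (if (i : ℕ) < k then 1 else 0) else 0) =
      prefixSum γ k + (∑ i : Fin r, if i = b then (if (i : ℕ) < k then 1 else 0) else 0) := by
    unfold prefixSum
    rw [← sum_add_distrib, ← sum_add_distrib]
    refine sum_congr rfl fun i _ => ?_
    have := hγ' i
    split_ifs at this ⊢ <;> omega
  simp only [sum_ite_eq', mem_univ, if_true] at h
  split_ifs at h ⊢ <;> omega

lemma exists_descent_of_prefixSum_lt {r : ℕ} {α γ : Fin r → ℕ} (hα : Antitone α)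
    (hsum : ∑ i, α i = ∑ i, γ i) {k : ℕ} (hk : prefixSum α k < prefixSum γ k) :
    ∃ a b : Fin r, (a : ℕ) + 1 = b ∧ γ b < γ a ∧ prefixSum α (a + 1) < prefixSum γ (a + 1) := by
  by_contra! hno
  classical
  have hex : ∃ k, prefixSum α k < prefixSum γ k := ⟨k, hk⟩
  obtain ⟨hl, hmin⟩ : prefixSum α (Nat.find hex) < prefixSum γ (Nat.find hex) ∧
      ∀ j < Nat.find hex, ¬ prefixSum α j < prefixSum γ j :=
    ⟨Nat.find_spec hex, fun j hj => Nat.find_min hex hj⟩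
  generalize Nat.find hex = l at hl hmin
  have hlr : l < r := by
    by_contra h
    rw [prefixSum_of_le _ (by omega), prefixSum_of_le _ (by omega)] at hl
    omega
  obtain _ | l := l
  · simp [prefixSum_zero] at hl
  have key : ∀ j, ∀ hj : l + j < r, prefixSum α (l + j + 1) < prefixSum γ (l + j + 1) ∧
      α ⟨l + j, hj⟩ < γ ⟨l + j, hj⟩ := by
    intro j
    induction j with
    | zero =>
      intro hj
      refine ⟨hl, ?_⟩
      have h1 := hmin l (by omega)
      have h2 := prefixSum_succ α ⟨l, hj⟩
      have h3 := prefixSum_succ γ ⟨l, hj⟩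
      simp only [add_zero] at h2 h3 ⊢
      omega
    | succ j ih =>
      intro hj
      obtain ⟨h1, h2⟩ := ih (by omega)
      have h3 : γ ⟨l + j, by omega⟩ ≤ γ ⟨l + (j + 1), hj⟩ := by
        by_contra h
        have := hno ⟨l + j, by omega⟩ ⟨l + (j + 1), hj⟩ rfl (by omega)
        simp only at this
        omega
      have h4 : α ⟨l + (j + 1), hj⟩ ≤ α ⟨l + j, by omega⟩ := hα (by
        rw [Fin.le_def]
        simp only
        omega)
      have h5 := prefixSum_succ α ⟨l + (j + 1), hj⟩
      have h6 := prefixSum_succ γ ⟨l + (j + 1), hj⟩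
      simp only [← add_assoc] at h3 h4 h5 h6 ⊢
      omega
  have := (key (r - 1 - l) (by omega)).1
  rw [prefixSum_of_le _ (by omega), prefixSum_of_le _ (by omega)] at this
  omega

lemma Realizable.of_dominated {n r : ℕ} {D : ℕ → Prop} {α γ : Fin r → ℕ}
    (h : Realizable n r D γ) (h2 : ∀ i, 2 ≤ γ i) (hα : Antitone α)
    (hsum : ∑ i, α i = ∑ i, γ i) (hle : ∀ k, prefixSum α k ≤ prefixSum γ k) :
    Realizable n r D α := by
  induction hN : ∑ k ∈ range r, (prefixSum γ k - prefixSum α k) using Nat.strong_induction_on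
    generalizing γ with
  | _ N ih =>
    by_cases hk : ∃ k, prefixSum α k < prefixSum γ k
    · obtain ⟨k, hk⟩ := hk
      obtain ⟨a, b, hab, hlt, hpre⟩ := exists_descent_of_prefixSum_lt hα hsum hk
      let γ' : Fin r → ℕ := fun j => γ j + (if j = b then 1 else 0) - (if j = a then 1 else 0)
      have hne : a ≠ b := by rintro rfl; omega
      have hγ' : ∀ j, γ' j + (if j = a then 1 else 0) = γ j + (if j = b then 1 else 0) := by
        intro j
        have := h2 j
        simp only [γ']
        split_ifs <;> omega
      have hp := prefixSum_transfer hab hγ'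
      have hle' : ∀ k, prefixSum α k ≤ prefixSum γ' k := by
        intro k
        have h1 := hp k
        have h3 := hle k
        split_ifs at h1 with hka
        · subst hka; omega
        · omega
      refine ih _ ?_ (h.shift_right h2 hab 1 (by omega) hγ') ?_ ?_ hle' rfl
      · rw [← hN]
        refine sum_lt_sum (fun k _ => ?_) ⟨a + 1, mem_range.2 (by omega), ?_⟩
        · have := hp k
          omega
        · have := hp (a + 1)
          rw [if_pos rfl] at this
          omega
      · intro j
        have h1 := hγ' j
        have h3 := h2 j
        have h4 := h2 b
        by_cases hja : j = a
        · subst hja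
          rw [if_pos rfl, if_neg hne] at h1
          omega
        · rw [if_neg hja] at h1
          omega
      · have h1 := hp r
        rw [if_neg (by omega), prefixSum_of_le _ le_rfl, prefixSum_of_le _ le_rfl] at h1
        omega
    · push Not at hk
      have : α = γ := by
        funext i
        have h1 := prefixSum_succ α i
        have h3 := prefixSum_succ γ i
        have := hk i
        have := hk (i + 1)
        have := hle i
        have := hle (i + 1)
        omega
      rwa [this]

lemma exists_perm_antitone {r : ℕ} (γ : Fin r → ℕ) :
    ∃ σ : Equiv.Perm (Fin r), Antitone (γ ∘ σ) :=
  ⟨Fin.revPerm.trans (Tuple.sort γ), fun _ _ h => Tuple.monotone_sort γ (Fin.rev_le_rev.2 h)⟩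

lemma map_val_comp_perm {r : ℕ} (γ : Fin r → ℕ) (σ : Equiv.Perm (Fin r)) :
    (univ : Finset (Fin r)).val.map (γ ∘ σ) = univ.val.map γ := by
  rw [← Multiset.map_map]
  congr 1
  have := congrArg Finset.val (Finset.map_univ_equiv σ)
  rwa [Finset.map_val] at this

lemma sortDesc_map_univ {r : ℕ} {γ : Fin r → ℕ} (hγ : Antitone γ) :
    sortDesc ((univ : Finset (Fin r)).val.map γ) = List.ofFn γ := by
  have hperm : (sortDesc ((univ : Finset (Fin r)).val.map γ)).Perm (List.ofFn γ) := by
    rw [← Multiset.coe_eq_coe, sortDesc, Multiset.coe_reverse, Multiset.sort_eq,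
      Fin.univ_val_map]
  refine hperm.eq_of_pairwise (le := fun a b => b ≤ a) (fun a b _ _ h1 h2 => le_antisymm h2 h1)
    ?_ ?_
  · rw [sortDesc, List.pairwise_reverse]
    exact Multiset.pairwise_sort _ _
  · exact List.pairwise_ofFn.2 fun i j h => hγ h.le

lemma dom_map_univ_iff {r r' : ℕ} {α : Fin r → ℕ} {β : Fin r' → ℕ} (hα : Antitone α)
    (hβ : Antitone β) : Dom (univ.val.map α) (univ.val.map β) ↔
      ∀ k, prefixSum α k ≤ prefixSum β k := by
  unfold Dom
  rw [sortDesc_map_univ hα, sortDesc_map_univ hβ]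
  simp only [List.sum_take_ofFn, prefixSum, sum_filter]

lemma prefixSum_le_sum {r : ℕ} (γ : Fin r → ℕ) (k : ℕ) : prefixSum γ k ≤ ∑ i, γ i :=
  sum_le_sum fun i _ => by split_ifs <;> omega

lemma prefixSum_le_of_sum_min_le {r r' : ℕ} {α : Fin r → ℕ} {β : Fin r' → ℕ} (hβ : Antitone β)
    (hsum : ∑ i, α i = ∑ i, β i) (hmin : ∀ j, ∑ i, min (β i) j ≤ ∑ i, min (α i) j) (k : ℕ) :
    prefixSum α k ≤ prefixSum β k := by
  rcases le_or_gt r' k with hk | hk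
  · rw [prefixSum_of_le β hk, ← hsum]
    exact prefixSum_le_sum α k
  have hcount : ∀ m, ∑ i : Fin m, (if (i : ℕ) < k then β ⟨k, hk⟩ else 0) =
      min m k * β ⟨k, hk⟩ := by
    intro m
    rw [← sum_filter, sum_const, smul_eq_mul, Fin.card_filter_val_lt]
  have h1 : prefixSum α k + ∑ i, min (α i) (β ⟨k, hk⟩) ≤ min r k * β ⟨k, hk⟩ + ∑ i, α i := by
    rw [← hcount, prefixSum, ← sum_add_distrib, ← sum_add_distrib]
    refine sum_le_sum fun i _ => ?_
    split_ifs <;> omega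
  have h2 : prefixSum β k + ∑ i, min (β i) (β ⟨k, hk⟩) = min r' k * β ⟨k, hk⟩ + ∑ i, β i := by
    rw [← hcount, prefixSum, ← sum_add_distrib, ← sum_add_distrib]
    refine sum_congr rfl fun i _ => ?_
    split_ifs with h
    · have := hβ (a := i) (b := ⟨k, hk⟩) (by rw [Fin.le_def]; exact h.le)
      omega
    · have := hβ (a := ⟨k, hk⟩) (b := i) (by rw [Fin.le_def]; exact not_lt.1 h)
      omega
  have h3 := hmin (β ⟨k, hk⟩)
  have h4 : min r k * β ⟨k, hk⟩ ≤ min r' k * β ⟨k, hk⟩ := Nat.mul_le_mul_right _ (by omega)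
  omega

/-- The cells `(i, k)` with `i < r` and `k < b i`. -/
def rowCells (r : ℕ) (b : ℕ → ℕ) : Finset ((_ : ℕ) × ℕ) :=
  (range r).sigma fun i => range (b i)

lemma mem_rowCells {r : ℕ} {b : ℕ → ℕ} {c : (_ : ℕ) × ℕ} :
    c ∈ rowCells r b ↔ c.1 < r ∧ c.2 < b c.1 := by
  simp [rowCells]

lemma card_rowCells (r : ℕ) (b : ℕ → ℕ) : (rowCells r b).card = ∑ i ∈ range r, b i := by
  simp [rowCells]

/-- `e` lists the elements of `C` by increasing `h`, ties being broken lexicographically. -/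
structure IsListing (C : Finset ((_ : ℕ) × ℕ)) (h : (_ : ℕ) × ℕ → ℕ) (e : ℕ → (_ : ℕ) × ℕ) :
    Prop where
  bijOn : Set.BijOn e (range C.card) C
  lt : ∀ p q, p < q → q < C.card → h (e p) < h (e q) ∨ h (e p) = h (e q) ∧
    ((e p).1 < (e q).1 ∨ (e p).1 = (e q).1 ∧ (e p).2 < (e q).2)

lemma exists_isListing (C : Finset ((_ : ℕ) × ℕ)) (h : (_ : ℕ) × ℕ → ℕ) :
    ∃ e, IsListing C h e := by
  let K : (_ : ℕ) × ℕ → ℕ ×ₗ (ℕ ×ₗ ℕ) := fun c => toLex (h c, toLex (c.1, c.2))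
  let L : ℕ ×ₗ (ℕ ×ₗ ℕ) → (_ : ℕ) × ℕ := fun x =>
    ⟨(ofLex (ofLex x).2).1, (ofLex (ofLex x).2).2⟩
  have hLK : ∀ c, L (K c) = c := fun c => rfl
  have hK : Function.Injective K := Function.LeftInverse.injective hLK
  have hcard : (C.image K).card = C.card := card_image_of_injective _ hK
  let g := (C.image K).orderEmbOfFin hcard
  have hg : ∀ p, ∃ c ∈ C, K c = g p := fun p =>
    mem_image.1 ((C.image K).orderEmbOfFin_mem hcard p)
  have hKL : ∀ p, K (L (g p)) = g p := fun p => by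
    obtain ⟨c, -, hc⟩ := hg p
    rw [← hc, hLK]
  refine ⟨fun p => if hp : p < C.card then L (g ⟨p, hp⟩) else ⟨0, 0⟩, ⟨?_, ?_, ?_⟩, ?_⟩
  · intro p hp
    have hp' : p < C.card := by simpa using hp
    obtain ⟨c, hcC, hc⟩ := hg ⟨p, hp'⟩
    simp only [dif_pos hp']
    rw [← hc, hLK]
    exact hcC
  · intro p hp q hq hpq
    have hp' : p < C.card := by simpa using hp
    have hq' : q < C.card := by simpa using hq
    simp only [dif_pos hp', dif_pos hq'] at hpq
    have := congrArg K hpq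
    rw [hKL, hKL] at this
    simpa using g.injective this
  · intro c hc
    have : K c ∈ Set.range g := by
      rw [range_orderEmbOfFin]
      exact mem_coe.2 (mem_image_of_mem K hc)
    obtain ⟨p, hp⟩ := this
    refine ⟨p, by simp, ?_⟩
    simp only [dif_pos p.2]
    rw [hp, hLK]
  · intro p q hpq hq
    have hp : p < C.card := hpq.trans hq
    simp only [dif_pos hp, dif_pos hq]
    have hlt : g ⟨p, hp⟩ < g ⟨q, hq⟩ := g.strictMono hpq
    rw [← hKL, ← hKL ⟨q, hq⟩] at hlt
    simpa [K, Prod.Lex.lt_iff] using hlt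

namespace IsListing

variable {C : Finset ((_ : ℕ) × ℕ)} {h : (_ : ℕ) × ℕ → ℕ} {e : ℕ → (_ : ℕ) × ℕ}

lemma card_filter (he : IsListing C h e) (P : (_ : ℕ) × ℕ → Prop) [DecidablePred P] :
    ((range C.card).filter (fun p => P (e p))).card = (C.filter P).card := by
  refine card_nbij e ?_ (he.bijOn.injOn.mono fun p hp => mem_coe.2 (mem_filter.1 hp).1) ?_
  · intro p hp
    simp only [coe_filter, Set.mem_ofPred_eq] at hp ⊢
    exact ⟨he.bijOn.mapsTo hp.1, hp.2⟩
  · intro c hc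
    simp only [coe_filter, Set.mem_ofPred_eq] at hc
    obtain ⟨p, hp, rfl⟩ := he.bijOn.surjOn hc.1
    exact ⟨p, by simpa using ⟨by simpa using hp, hc.2⟩, rfl⟩

lemma mono (he : IsListing C h e) {p q : ℕ} (hpq : p ≤ q) (hq : q < C.card) :
    h (e p) ≤ h (e q) := by
  rcases hpq.eq_or_lt with rfl | hpq
  · exact le_rfl
  · have := he.lt p q hpq hq
    omega

lemma isLinkedWord {r : ℕ} {b : ℕ → ℕ} (he : IsListing (rowCells r b) h e)
    (hlink : ∀ i, i + 1 < r → ∃ c ∈ rowCells r b, ∃ c' ∈ rowCells r b,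
      c.1 = i ∧ c'.1 = i + 1 ∧ (h c < h c' ∨ h c = h c')) :
    IsLinkedWord (rowCells r b).card r (fun p => (e p).1 < (e (p + 1)).1) (fun p => (e p).1) where
  lt p hp := (mem_rowCells.1 (he.bijOn.mapsTo (by simpa using hp))).1
  asc p _ := Iff.rfl
  link i hi := by
    obtain ⟨c, hc, c', hc', h1, h2, h3⟩ := hlink i hi
    obtain ⟨p, hp, rfl⟩ := he.bijOn.surjOn hc
    obtain ⟨q, hq, rfl⟩ := he.bijOn.surjOn hc'
    simp only [coe_range, Set.mem_Iio] at hp hq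
    refine ⟨p, q, ?_, hq, h1, h2⟩
    by_contra hpq
    rcases (not_lt.1 hpq).eq_or_lt with rfl | hpq
    · omega
    · have := he.lt q p hpq hp
      omega

lemma letterCount_eq {r : ℕ} {b : ℕ → ℕ} (he : IsListing (rowCells r b) h e) {i : ℕ}
    (hi : i < r) : letterCount (rowCells r b).card (fun p => (e p).1) i = b i := by
  rw [letterCount, he.card_filter fun c => c.1 = i]
  calc _ = ((range (b i)).map
        ⟨fun k => (⟨i, k⟩ : (_ : ℕ) × ℕ), fun k k' h => by simpa using h⟩).card := by
        congr 1
        ext ⟨a, k⟩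
        simp only [mem_filter, mem_rowCells, mem_map, mem_range]
        constructor
        · rintro ⟨⟨-, hk⟩, rfl⟩
          exact ⟨k, hk, rfl⟩
        · rintro ⟨k', hk', h⟩
          cases h
          exact ⟨⟨hi, hk'⟩, rfl⟩
    _ = b i := by rw [card_map, card_range]

end IsListing

/-- The extension by zero of a function on `Fin r`. -/
def extendZero {r : ℕ} (γ : Fin r → ℕ) (i : ℕ) : ℕ := if hi : i < r then γ ⟨i, hi⟩ else 0

lemma extendZero_val {r : ℕ} (γ : Fin r → ℕ) (i : Fin r) : extendZero γ i = γ i := dif_pos i.2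

lemma card_rowCells_extendZero {r : ℕ} (γ : Fin r → ℕ) :
    (rowCells r (extendZero γ)).card = ∑ i, γ i := by
  rw [card_rowCells, sum_range]
  simp only [extendZero_val]

lemma IsLinkedWord.lt_of_ascents {n r : ℕ} {D : ℕ → Prop} {f : ℕ → ℕ}
    (hf : IsLinkedWord n r D f) {p q : ℕ} (hpq : p < q) (hq : q < n)
    (hD : ∀ t, p ≤ t → t < q → D t) : f p < f q := by
  induction q, hpq using Nat.le_induction with
  | base => exact (hf.asc p hq).2 (hD p le_rfl (by omega))
  | succ q hpq ih =>
    exact (ih (by omega) fun t h1 h2 => hD t h1 (by omega)).trans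
      ((hf.asc q hq).2 (hD q (by omega) (by omega)))

lemma IsLinkedWord.le_of_not_ascents {n r : ℕ} {D : ℕ → Prop} {f : ℕ → ℕ}
    (hf : IsLinkedWord n r D f) {p q : ℕ} (hpq : p < q) (hq : q < n)
    (hD : ∀ t, p ≤ t → t < q → ¬ D t) : f q ≤ f p := by
  induction q, hpq using Nat.le_induction with
  | base => exact not_lt.1 ((hf.asc p hq).not.2 (hD p le_rfl (by omega)))
  | succ q hpq ih =>
    exact (not_lt.1 ((hf.asc q hq).not.2 (hD q (by omega) (by omega)))).trans
      (ih (by omega) fun t h1 h2 => hD t h1 (by omega))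

/-- Reading a ribbon of content `β` by columns of its left-justified rows gives an ascent set that
detects the sums `∑ min (β i) j`. -/
lemma exists_realizable_sum_min_le {r : ℕ} (β : Fin r → ℕ) (h1 : ∀ i, 1 ≤ β i) :
    ∃ D, Realizable (∑ i, β i) r D β ∧ ∀ r' (α : Fin r' → ℕ),
      Realizable (∑ i, β i) r' D α → ∀ j, ∑ i, min (β i) j ≤ ∑ i, min (α i) j := by
  obtain ⟨e, he⟩ := exists_isListing (rowCells r (extendZero β)) (fun c => c.2)
  rw [← card_rowCells_extendZero]
  refine ⟨_, ⟨_, he.isLinkedWord fun i hi => ?_, fun i => ?_⟩, ?_⟩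
  · have hb : ∀ j < r, 0 < extendZero β j := fun j hj => by
      rw [extendZero, dif_pos hj]
      exact h1 _
    exact ⟨⟨i, 0⟩, mem_rowCells.2 ⟨by simp only; omega, hb i (by omega)⟩, ⟨i + 1, 0⟩,
      mem_rowCells.2 ⟨hi, hb _ hi⟩, rfl, rfl, Or.inr rfl⟩
  · rw [he.letterCount_eq i.2, extendZero_val]
  rintro r' α ⟨f, hf, hc⟩ j
  have hC := card_rowCells_extendZero (fun i => min (β i) j)
  have hinj : ∀ p q, p < q → q < (rowCells r (extendZero β)).card → (e p).2 = (e q).2 →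
      f p < f q := by
    intro p q hpq hq hpq2
    refine hf.lt_of_ascents hpq hq fun t ht1 ht2 => ?_
    have a1 := he.mono ht1 (by omega)
    have a2 := he.mono (p := t + 1) (q := q) ht2 hq
    have a3 := he.lt t (t + 1) (by omega) (by omega)
    omega
  calc ∑ i, min (β i) j
      = ((rowCells r (extendZero β)).filter (fun c => c.2 < j)).card := by
        rw [← hC]
        congr 1
        ext c
        simp only [mem_filter, mem_rowCells, extendZero]
        constructor
        · rintro ⟨hc, h⟩
          rw [dif_pos hc] at h ⊢
          omega
        · rintro ⟨⟨hc, h⟩, h'⟩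
          rw [dif_pos hc] at h ⊢
          omega
    _ = ((range (rowCells r (extendZero β)).card).filter (fun p => (e p).2 < j)).card :=
        (he.card_filter fun c => c.2 < j).symm
    _ = ∑ i ∈ range r', (((range (rowCells r (extendZero β)).card).filter
          (fun p => (e p).2 < j)).filter (fun p => f p = i)).card := by
        refine card_eq_sum_card_fiberwise fun p hp => ?_
        simp only [coe_filter, mem_range, Set.mem_ofPred_eq, coe_range, Set.mem_Iio] at hp ⊢
        exact hf.lt p hp.1
    _ = ∑ i : Fin r', (((range (rowCells r (extendZero β)).card).filter
          (fun p => (e p).2 < j)).filter (fun p => f p = i)).card := sum_range _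
    _ ≤ ∑ i, min (α i) j := by
        refine sum_le_sum fun i _ => le_min ?_ ?_
        · rw [← hc, letterCount]
          refine card_le_card fun p hp => ?_
          simp only [mem_filter] at hp ⊢
          exact ⟨hp.1.1, hp.2⟩
        · conv_rhs => rw [← card_range j]
          refine card_le_card_of_injOn (fun p => (e p).2) ?_ ?_
          · intro p hp
            simp only [coe_filter, mem_filter, Set.mem_ofPred_eq, coe_range, Set.mem_Iio] at hp ⊢
            exact hp.1.2
          · intro p hp q hq hpq
            simp only [coe_filter, mem_filter, mem_range, Set.mem_ofPred_eq] at hp hq hpq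
            rcases lt_trichotomy p q with h | h | h
            · have := hinj p q h hq.1.1 hpq
              omega
            · exact h
            · have := hinj q p h hp.1.1 hpq.symm
              omega

/-- A long initial descending run bounds the number of letters of a linked word. -/
lemma exists_realizable_le {r : ℕ} (β : Fin r → ℕ) (h2 : ∀ i, 2 ≤ β i) (hr : 0 < r) :
    ∃ D, Realizable (∑ i, β i) r D β ∧ ∀ r' (α : Fin r' → ℕ),
      Realizable (∑ i, β i) r' D α → r' ≤ r := by
  set b := extendZero β with hb
  have hb2 : ∀ j < r, 2 ≤ b j := fun j hj => by
    rw [hb, extendZero, dif_pos hj]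
    exact h2 _
  obtain ⟨h, hh⟩ : ∃ h : (_ : ℕ) × ℕ → ℕ,
      h = fun c => if c.2 + 1 < b c.1 then r - 1 - c.1 else r - 1 + c.1 := ⟨_, rfl⟩
  obtain ⟨e, he⟩ := exists_isListing (rowCells r b) h
  have hn : (rowCells r b).card = ∑ i, β i := card_rowCells_extendZero β
  rw [← hn]
  refine ⟨_, ⟨_, he.isLinkedWord fun i hi => ?_, fun i => ?_⟩, ?_⟩
  · have h1 := hb2 i (by omega)
    have h2 := hb2 (i + 1) hi
    refine ⟨⟨i, 0⟩, mem_rowCells.2 ⟨by simp only; omega, by simp only; omega⟩,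
      ⟨i + 1, b (i + 1) - 1⟩, mem_rowCells.2 ⟨hi, by simp only; omega⟩, rfl, rfl, Or.inl ?_⟩
    simp only [hh]
    rw [if_pos (by omega), if_neg (by omega)]
    omega
  · rw [he.letterCount_eq i.2, hb, extendZero_val]
  rintro r' α ⟨f, hf, -⟩
  have hletter : ∀ p < (rowCells r b).card, h (e p) < r → (e p).1 = r - 1 - h (e p) := by
    intro p hp hp'
    have := mem_rowCells.1 (he.bijOn.mapsTo (show p ∈ _ by simpa using hp))
    simp only [hh] at hp' ⊢
    split_ifs at hp' ⊢ <;> omega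
  have hlate : ∀ i, i + 1 < r' → ∃ q < (rowCells r b).card, r ≤ h (e q) ∧ f q = i + 1 := by
    intro i hi
    obtain ⟨p, q, hpq, hq, hp, hq'⟩ := hf.link i hi
    refine ⟨q, hq, ?_, hq'⟩
    by_contra hlt
    have hdesc : ∀ t, p ≤ t → t < q → ¬ (e t).1 < (e (t + 1)).1 := fun t ht1 ht2 => by
      have a1 := he.mono (p := t) (q := t + 1) (by omega) (by omega)
      have a2 := he.mono (p := t + 1) (q := q) ht2 hq
      have a3 := hletter t (by omega) (by omega)
      have a4 := hletter (t + 1) (by omega) (by omega)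
      omega
    have := hf.le_of_not_ascents hpq hq hdesc
    omega
  have hcard : ((range (rowCells r b).card).filter (fun p => r ≤ h (e p))).card ≤ r - 1 := by
    rw [he.card_filter fun c => r ≤ h c]
    have : (Ico 1 r).card = r - 1 := by simp
    rw [← this]
    refine card_le_card_of_injOn (fun c => c.1) ?_ ?_
    · intro c hc
      simp only [coe_filter, mem_rowCells, Set.mem_ofPred_eq, coe_Ico, Set.mem_Ico, hh] at hc ⊢
      split_ifs at hc <;> omega
    · rintro ⟨i, k⟩ hc ⟨i', k'⟩ hc' heq
      simp only [coe_filter, mem_rowCells, Set.mem_ofPred_eq, hh] at hc hc' heq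
      subst heq
      have : k = k' := by
        split_ifs at hc hc' <;> omega
      rw [this]
  have hle : (Ico 1 r').card ≤ ((range (rowCells r b).card).filter
      (fun p => r ≤ h (e p))).card := by
    refine card_le_card_of_surjOn f fun i hi => ?_
    simp only [coe_Ico, Set.mem_Ico] at hi
    obtain ⟨q, hq, hq1, hq2⟩ := hlate (i - 1) (by omega)
    exact ⟨q, by simpa using ⟨hq, hq1⟩, by omega⟩
  rw [Nat.card_Ico] at hle
  omega

/-- The cell set `s` consists of the rows `r₀ + t`, `t < r`, where row `r₀ + t` occupies the
columns `m t, …, m t + γ t - 1`, adjacent rows overlapping in exactly one column. -/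
structure IsRibbonRows (s : Finset (ℕ × ℕ)) (r₀ r : ℕ) (m γ : ℕ → ℕ) : Prop where
  pos : 0 < r
  mem : ∀ i j, (i, j) ∈ s ↔ ∃ t < r, i = r₀ + t ∧ m t ≤ j ∧ j < m t + γ t
  two_le : ∀ t < r, 2 ≤ γ t
  overlap : ∀ t, t + 1 < r → m (t + 1) + γ (t + 1) = m t + 1

lemma mem_rowCols {s : Finset (ℕ × ℕ)} {i j : ℕ} : j ∈ rowCols s i ↔ (i, j) ∈ s := by
  simp only [rowCols, mem_image, mem_filter, Prod.exists, exists_eq_right]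

lemma SkewShape.rowCols_cells (A : SkewShape) (i : ℕ) :
    rowCols A.cells i = Ico (A.mu.rowLen i) (A.lam.rowLen i) := by
  ext j
  rw [mem_rowCols, SkewShape.cells, mem_sdiff, YoungDiagram.mem_cells, YoungDiagram.mem_cells,
    YoungDiagram.mem_iff_lt_rowLen, YoungDiagram.mem_iff_lt_rowLen, mem_Ico, not_lt, and_comm]

lemma ElongatedRibbon.exists_isRibbonRows {A : SkewShape} (hA : ElongatedRibbon A) :
    ∃ r₀ r m γ, IsRibbonRows A.cells r₀ r m γ := by
  obtain ⟨⟨r0, r1, h01, hne, hov⟩, h2⟩ := hA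
  have key : ∀ i, r0 ≤ i → i ≤ r1 → 2 ≤ A.lam.rowLen i - A.mu.rowLen i := fun i h0 h1 => by
    have := h2 i ((hne i).2 ⟨h0, h1⟩)
    rwa [A.rowCols_cells, Nat.card_Ico] at this
  refine ⟨r0, r1 + 1 - r0, fun t => A.mu.rowLen (r0 + t),
    fun t => A.lam.rowLen (r0 + t) - A.mu.rowLen (r0 + t), by omega, fun i j => ?_,
    fun t ht => key _ (by omega) (by omega), fun t ht => ?_⟩
  · rw [← mem_rowCols]
    constructor
    · intro h
      have hi := (hne i).1 ⟨j, h⟩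
      rw [A.rowCols_cells, mem_Ico] at h
      refine ⟨i - r0, by omega, by omega, ?_⟩
      rw [Nat.add_sub_cancel' hi.1]
      omega
    · rintro ⟨t, ht, rfl, h⟩
      rw [A.rowCols_cells, mem_Ico]
      omega
  · have h := hov (r0 + t) (by omega) (by omega)
    rw [A.rowCols_cells, A.rowCols_cells, Ico_inter_Ico, Nat.card_Ico,
      max_eq_left (A.mu.rowLen_anti _ _ (Nat.le_succ _)),
      min_eq_right (A.lam.rowLen_anti _ _ (Nat.le_succ _))] at h
    have := key (r0 + t + 1) (by omega) (by omega)
    simp only [← add_assoc]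
    have := A.mu.rowLen_anti _ _ (Nat.le_succ (r0 + t))
    simp only [Nat.succ_eq_add_one] at *
    omega

namespace IsRibbonRows

variable {s : Finset (ℕ × ℕ)} {r₀ r : ℕ} {m γ : ℕ → ℕ}

lemma mem_iff (h : IsRibbonRows s r₀ r m γ) {t j : ℕ} (ht : t < r) :
    (r₀ + t, j) ∈ s ↔ m t ≤ j ∧ j < m t + γ t := by
  rw [h.mem]
  constructor
  · rintro ⟨t', ht', heq, h⟩
    obtain rfl : t = t' := by omega
    exact h
  · exact fun h => ⟨t, ht, rfl, h⟩

lemma lt_of_mem (h : IsRibbonRows s r₀ r m γ) {t j : ℕ} (ht : (r₀ + t, j) ∈ s) : t < r := by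
  obtain ⟨t', ht', heq, -⟩ := (h.mem _ _).1 ht
  omega

lemma lt_of_lt (h : IsRibbonRows s r₀ r m γ) {t t' : ℕ} (htt' : t < t') (ht' : t' < r) :
    m t' < m t := by
  induction t', htt' using Nat.le_induction with
  | base =>
    have := h.overlap t ht'
    have := h.two_le (t + 1) ht'
    change m (t + 1) < m t
    omega
  | succ t' htt' ih =>
    have := ih (by omega)
    have := h.overlap t' ht'
    have := h.two_le _ ht'
    omega

/-- A column of a ribbon has at most two cells, in adjacent rows. -/
lemma eq_of_mem_of_mem (h : IsRibbonRows s r₀ r m γ) {t t' j : ℕ} (htt' : t < t') (ht' : t' < r)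
    (h1 : m t ≤ j) (h2 : j < m t' + γ t') : t' = t + 1 ∧ j = m t := by
  obtain ⟨u, rfl⟩ : ∃ u, t' = u + 1 := ⟨t' - 1, by omega⟩
  have := h.overlap u ht'
  obtain rfl | hlt : t = u ∨ t < u := by omega
  · exact ⟨rfl, by omega⟩
  · have := h.lt_of_lt hlt (by omega)
    omega

lemma card_eq (h : IsRibbonRows s r₀ r m γ) : s.card = ∑ t ∈ range r, γ t := by
  have : s = (range r).biUnion fun t => (Ico (m t) (m t + γ t)).image fun j => (r₀ + t, j) := by
    ext ⟨i, j⟩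
    rw [h.mem]
    simp only [mem_biUnion, mem_range, mem_image, mem_Ico, Prod.mk.injEq]
    constructor
    · rintro ⟨t, ht, rfl, hj⟩
      exact ⟨t, ht, j, hj, rfl, rfl⟩
    · rintro ⟨t, ht, j, hj, rfl, rfl⟩
      exact ⟨t, ht, rfl, hj⟩
  rw [this, card_biUnion]
  · refine sum_congr rfl fun t _ => ?_
    rw [card_image_of_injective _ (Prod.mk_right_injective _), Nat.card_Ico]
    omega
  · intro t _ t' _ htt'
    refine disjoint_left.2 fun c hc hc' => ?_
    obtain ⟨j, -, rfl⟩ := mem_image.1 hc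
    obtain ⟨j', -, hj'⟩ := mem_image.1 hc'
    have := congrArg Prod.fst hj'
    simp only at this
    omega

lemma image_fst (h : IsRibbonRows s r₀ r m γ) :
    (s.image Prod.fst).val = (Multiset.range r).map (r₀ + ·) := by
  have : s.image Prod.fst = (range r).map (addLeftEmbedding r₀) := by
    ext i
    simp only [mem_image, Prod.exists, exists_and_right, exists_eq_right, mem_map, mem_range,
      addLeftEmbedding_apply]
    constructor
    · rintro ⟨j, hj⟩
      obtain ⟨t, ht, rfl, -⟩ := (h.mem _ _).1 hj
      exact ⟨t, ht, rfl⟩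
    · rintro ⟨t, ht, rfl⟩
      have := h.two_le t ht
      exact ⟨m t, (h.mem_iff ht).2 (by omega)⟩
  rw [this, map_val, range_val]
  rfl

lemma overlapRow_one (h : IsRibbonRows s r₀ r m γ) {t : ℕ} (ht : t < r) :
    overlapRow s 1 (r₀ + t) = γ t := by
  have : rowCols s (r₀ + t) = Ico (m t) (m t + γ t) := by
    ext j
    rw [mem_rowCols, h.mem_iff ht, mem_Ico]
  rw [overlapRow, filter_true_of_mem, this, Nat.card_Ico]
  · omega
  · intro j hj u hu
    obtain rfl : u = 0 := by omega
    exact hj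

lemma overlapRow_two (h : IsRibbonRows s r₀ r m γ) {t : ℕ} (ht : t < r) :
    overlapRow s 2 (r₀ + t) = if t + 1 < r then 1 else 0 := by
  split_ifs with ht'
  · refine card_eq_one.2 ⟨m t, ?_⟩
    have h1 := h.overlap t ht'
    have h2 := h.two_le t ht
    have h3 := h.two_le _ ht'
    ext j
    rw [mem_filter, mem_rowCols, h.mem_iff ht, mem_singleton]
    constructor
    · rintro ⟨hj, hj'⟩
      have := (h.mem_iff ht').1 (mem_rowCols.1 (hj' 1 (by omega)))
      omega
    · rintro rfl
      refine ⟨by omega, fun u hu => mem_rowCols.2 ?_⟩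
      interval_cases u
      · exact (h.mem_iff ht).2 (by omega)
      · exact (h.mem_iff ht').2 (by omega)
  · refine card_eq_zero.2 (filter_eq_empty_iff.2 fun j _ hj => ht' ?_)
    exact h.lt_of_mem (mem_rowCols.1 (hj 1 (by omega)))

lemma overlapRow_eq_zero (h : IsRibbonRows s r₀ r m γ) {k t : ℕ} (hk : 3 ≤ k) (ht : t < r) :
    overlapRow s k (r₀ + t) = 0 := by
  refine card_eq_zero.2 (filter_eq_empty_iff.2 fun j hj hj' => ?_)
  have h0 := mem_rowCols.1 hj
  have h2 := mem_rowCols.1 (hj' 2 (by omega))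
  rw [add_assoc] at h2
  have ht2 := h.lt_of_mem h2
  have := h.eq_of_mem_of_mem (by omega) ht2 ((h.mem_iff ht).1 h0).1 ((h.mem_iff ht2).1 h2).2
  omega

lemma rowsk_eq (h : IsRibbonRows s r₀ r m γ) {k : ℕ} {g : ℕ → ℕ}
    (hg : ∀ t < r, overlapRow s k (r₀ + t) = g t) :
    rowsk s k = ((Multiset.range r).map g).filter (fun x => 0 < x) := by
  rw [rowsk, h.image_fst, Multiset.map_map]
  congr 1
  exact Multiset.map_congr rfl fun t ht => hg t (Multiset.mem_range.1 ht)

lemma rowsk_one (h : IsRibbonRows s r₀ r m γ) :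
    rowsk s 1 = univ.val.map fun i : Fin r => γ i := by
  rw [h.rowsk_eq fun t ht => h.overlapRow_one ht, Multiset.filter_eq_self.2]
  · rw [← range_val, ← Nat.Iio_eq_range, ← Fin.map_valEmbedding_univ, map_val, Multiset.map_map]
    rfl
  · intro x hx
    obtain ⟨t, ht, rfl⟩ := Multiset.mem_map.1 hx
    have := h.two_le t (Multiset.mem_range.1 ht)
    omega

lemma rowsk_two (h : IsRibbonRows s r₀ r m γ) : rowsk s 2 = Multiset.replicate (r - 1) 1 := by
  rw [h.rowsk_eq fun t ht => h.overlapRow_two ht, Multiset.eq_replicate]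
  constructor
  · have : (range r).filter (fun t => 0 < if t + 1 < r then 1 else 0) = range (r - 1) := by
      ext t
      rw [mem_filter, mem_range, mem_range]
      split_ifs <;> omega
    rw [Multiset.filter_map, Multiset.card_map]
    have h' := congrArg card this
    rw [card_range] at h'
    exact h'
  · intro x hx
    obtain ⟨hx, hpos⟩ := Multiset.mem_filter.1 hx
    obtain ⟨t, -, rfl⟩ := Multiset.mem_map.1 hx
    split_ifs at hpos ⊢
    · rfl
    · omega

lemma rowsk_eq_zero (h : IsRibbonRows s r₀ r m γ) {k : ℕ} (hk : 3 ≤ k) : rowsk s k = 0 := by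
  rw [h.rowsk_eq fun t ht => h.overlapRow_eq_zero hk ht]
  refine Multiset.filter_eq_nil.2 fun x hx => ?_
  obtain ⟨t, -, rfl⟩ := Multiset.mem_map.1 hx
  exact lt_irrefl 0

end IsRibbonRows

lemma sortDesc_sum (s : Multiset ℕ) : (sortDesc s).sum = s.sum := by
  rw [sortDesc, List.sum_reverse, ← Multiset.sum_coe, Multiset.sort_eq]

lemma length_sortDesc (s : Multiset ℕ) : (sortDesc s).length = Multiset.card s := by
  rw [sortDesc, List.length_reverse, Multiset.length_sort]

lemma mem_sortDesc {s : Multiset ℕ} {x : ℕ} : x ∈ sortDesc s ↔ x ∈ s := by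
  rw [sortDesc, List.mem_reverse, Multiset.mem_sort]

lemma Dom.sum_le {s t : Multiset ℕ} (h : Dom s t) : s.sum ≤ t.sum := by
  have := h (Multiset.card s + Multiset.card t)
  rwa [List.take_of_length_le (by rw [length_sortDesc]; omega),
    List.take_of_length_le (by rw [length_sortDesc]; omega), sortDesc_sum, sortDesc_sum] at this

lemma Dom.card_le {s t : Multiset ℕ} (h : Dom s t) (hsum : s.sum = t.sum) (ht : ∀ x ∈ t, 0 < x) :
    Multiset.card t ≤ Multiset.card s := by
  have h1 := h (Multiset.card s)
  rw [List.take_of_length_le (length_sortDesc s).le, sortDesc_sum, hsum, ← sortDesc_sum t] at h1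
  have h2 := List.sum_take_add_sum_drop (sortDesc t) (Multiset.card s)
  by_contra! hlt
  have h3 : ((sortDesc t).drop (Multiset.card s)).sum = 0 := by omega
  rw [List.sum_eq_zero_iff] at h3
  have hlt' : Multiset.card s < (sortDesc t).length := by rwa [length_sortDesc]
  have h4 := h3 _ (List.getElem_mem (l := (sortDesc t).drop (Multiset.card s)) (n := 0)
    (by rw [List.length_drop]; omega))
  rw [List.getElem_drop] at h4
  have := ht _ (mem_sortDesc.1 (List.getElem_mem (l := sortDesc t)
    (n := Multiset.card s + 0) (by omega)))
  omega

/-- The word recording the rows of the entries of a standard Young tableau of ribbon shape. -/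
lemma SYT.realizable {A : SkewShape} {r₀ r : ℕ} {m γ : ℕ → ℕ}
    (h : IsRibbonRows A.cells r₀ r m γ) (T : SYT A) :
    Realizable A.size r (fun p => p + 1 ∈ T.descentSet) fun i : Fin r => γ i := by
  have himage : A.cells.image T.entry = Icc 1 A.size := by
    refine eq_of_subset_of_card_le (image_subset_iff.2 T.mem_range) ?_
    rw [card_image_of_injOn T.injOn, Nat.card_Icc, Nat.add_sub_cancel, SkewShape.size]
  have hex : ∀ p, ∃ c, p < A.size → c ∈ A.cells ∧ T.entry c = p + 1 := fun p => by
    by_cases hp : p < A.size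
    · have : p + 1 ∈ A.cells.image T.entry := by
        rw [himage, mem_Icc]
        omega
      obtain ⟨c, hc, hc'⟩ := mem_image.1 this
      exact ⟨c, fun _ => ⟨hc, hc'⟩⟩
    · exact ⟨(0, 0), fun h => absurd h hp⟩
  choose e he using hex
  have hfst : ∀ c ∈ A.cells, r₀ ≤ c.1 ∧ c.1 - r₀ < r := fun ⟨i, j⟩ hc => by
    obtain ⟨t, ht, rfl, -⟩ := (h.mem _ _).1 hc
    exact ⟨Nat.le_add_right _ _, by simpa using ht⟩
  have huniq : ∀ c ∈ A.cells, T.entry c - 1 < A.size ∧ e (T.entry c - 1) = c := fun c hc => by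
    have hc' := mem_Icc.1 (T.mem_range c hc)
    have hlt : T.entry c - 1 < A.size := by omega
    obtain ⟨h1, h2⟩ := he _ hlt
    exact ⟨hlt, T.injOn h1 hc (by omega)⟩
  refine ⟨fun p => (e p).1 - r₀, ⟨fun p hp => (hfst _ (he p hp).1).2, fun p hp => ?_,
    fun i hi => ?_⟩, fun i => ?_⟩
  · obtain ⟨h1, h2⟩ := he p (by omega)
    obtain ⟨h3, h4⟩ := he (p + 1) hp
    have h5 := (hfst _ h1).1
    have h6 := (hfst _ h3).1
    rw [SYT.descentSet, mem_filter, mem_Ico]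
    constructor
    · exact fun hlt => ⟨⟨by omega, hp⟩, _, h1, _, h3, h2, h4, by omega⟩
    · rintro ⟨-, c, hc, c', hc', hcp, hcp', hlt⟩
      have h7 := (huniq c hc).2
      have h8 := (huniq c' hc').2
      rw [hcp, Nat.add_sub_cancel] at h7
      rw [hcp', Nat.add_sub_cancel] at h8
      simp only [h7, h8] at h5 h6 ⊢
      omega
  · have g1 := h.overlap i hi
    have g2 := h.two_le i (by omega)
    have g3 := h.two_le _ hi
    have c1 := (h.mem_iff (j := m i) (by omega)).2 ⟨le_rfl, by omega⟩
    have c2 := (h.mem_iff (j := m i) hi).2 ⟨by omega, by omega⟩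
    have hlt := T.col_lt _ _ _ c1 c2 (by omega)
    obtain ⟨u1, u2⟩ := huniq _ c1
    obtain ⟨u3, u4⟩ := huniq _ c2
    have := mem_Icc.1 (T.mem_range _ c1)
    refine ⟨T.entry (r₀ + i, m i) - 1, T.entry (r₀ + (i + 1), m i) - 1, by omega, u3, ?_, ?_⟩
    · rw [u2, Nat.add_sub_cancel_left]
    · rw [u4, Nat.add_sub_cancel_left]
  · have hi := i.2
    have : γ i = (Ico (m i) (m i + γ i)).card := by
      rw [Nat.card_Ico]
      omega
    simp only
    rw [this, letterCount]
    symm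
    refine card_nbij (fun j => T.entry (r₀ + i, j) - 1) ?_ ?_ ?_
    · intro j hj
      have hc := (h.mem_iff hi).2 (mem_Ico.1 (mem_coe.1 hj))
      obtain ⟨h1, h2⟩ := huniq _ hc
      rw [mem_coe, mem_filter, Finset.mem_range, h2]
      exact ⟨h1, by simp⟩
    · intro j hj j' hj' heq
      have h1 := (huniq _ ((h.mem_iff hi).2 (mem_Ico.1 (mem_coe.1 hj)))).2
      have h2 := (huniq _ ((h.mem_iff hi).2 (mem_Ico.1 (mem_coe.1 hj')))).2
      simp only at heq
      rw [heq, h2] at h1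
      exact (congrArg Prod.snd h1).symm
    · intro p hp
      obtain ⟨hp, hpi⟩ := mem_filter.1 (mem_coe.1 hp)
      obtain ⟨h1, h2⟩ := he p (Finset.mem_range.1 hp)
      have heq : e p = (r₀ + i, (e p).2) := by
        have := (hfst _ h1).1
        ext
        · simp only
          omega
        · rfl
      refine ⟨(e p).2, ?_, ?_⟩
      · rw [heq, h.mem_iff hi] at h1
        exact mem_coe.2 (mem_Ico.2 h1)
      · simp only
        rw [← heq, h2, Nat.add_sub_cancel]

section

variable {n : ℕ} {f : ℕ → ℕ} {t : ℕ}

lemma finite_positions (n : ℕ) (f : ℕ → ℕ) (t : ℕ) : {p | p < n ∧ f p = t}.Finite :=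
  (Set.finite_Iio n).subset fun _ hp => hp.1

lemma card_positions (n : ℕ) (f : ℕ → ℕ) (t : ℕ) :
    (finite_positions n f t).toFinset.card = letterCount n f t := by
  rw [letterCount]
  congr 1
  ext p
  simp

lemma nth_position_mem {s : ℕ} (hs : s < letterCount n f t) :
    Nat.nth (fun p => p < n ∧ f p = t) s < n ∧ f (Nat.nth (fun p => p < n ∧ f p = t) s) = t :=
  Nat.nth_mem_of_lt_card (finite_positions n f t) (by rwa [card_positions])

lemma nth_position_lt {s s' : ℕ} (hss' : s < s') (hs' : s' < letterCount n f t) :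
    Nat.nth (fun p => p < n ∧ f p = t) s < Nat.nth (fun p => p < n ∧ f p = t) s' :=
  Nat.nth_lt_nth_of_lt_card (finite_positions n f t) hss' (by rwa [card_positions])

lemma exists_nth_position_eq {p : ℕ} (hp : p < n) (hpt : f p = t) :
    ∃ s < letterCount n f t, Nat.nth (fun p => p < n ∧ f p = t) s = p := by
  obtain ⟨s, hs, h⟩ := Nat.exists_lt_card_finite_nth_eq (p := fun p => p < n ∧ f p = t)
    (finite_positions n f t) ⟨hp, hpt⟩
  exact ⟨s, by rwa [card_positions] at hs, h⟩

end

/-- A linked word gives a standard Young tableau of ribbon shape with the same descents. -/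
lemma Realizable.exists_SYT {A : SkewShape} {r₀ r : ℕ} {m γ : ℕ → ℕ}
    (h : IsRibbonRows A.cells r₀ r m γ) {D : ℕ → Prop}
    (hD : Realizable A.size r D fun i : Fin r => γ i) :
    ∃ T : SYT A, ∀ k ∈ Ico 1 A.size, k ∈ T.descentSet ↔ D (k - 1) := by
  obtain ⟨f, hf, hcount⟩ := hD
  have hcount' : ∀ t < r, letterCount A.size f t = γ t := fun t ht => hcount ⟨t, ht⟩
  let N : ℕ → ℕ → ℕ := fun t s => Nat.nth (fun p => p < A.size ∧ f p = t) s
  let entry : ℕ × ℕ → ℕ := fun c =>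
    if c ∈ A.cells then 1 + N (c.1 - r₀) (c.2 - m (c.1 - r₀)) else 0
  have hentry : ∀ t s, t < r → s < γ t →
      (r₀ + t, m t + s) ∈ A.cells ∧ entry (r₀ + t, m t + s) = 1 + N t s := fun t s ht hs => by
    have hc : (r₀ + t, m t + s) ∈ A.cells := (h.mem_iff ht).2 (by omega)
    refine ⟨hc, ?_⟩
    simp only [entry]
    rw [if_pos hc, Nat.add_sub_cancel_left, Nat.add_sub_cancel_left]
  have hcells : ∀ i j, (i, j) ∈ A.cells → ∃ t s, t < r ∧ s < γ t ∧ i = r₀ + t ∧ j = m t + s := by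
    intro i j hc
    obtain ⟨t, ht, hi, h1, h2⟩ := (h.mem i j).1 hc
    exact ⟨t, j - m t, ht, by omega, hi, by omega⟩
  have hN : ∀ t s, t < r → s < γ t → N t s < A.size ∧ f (N t s) = t := fun t s ht hs =>
    nth_position_mem (by rwa [hcount' t ht])
  have hNlt : ∀ t s s', t < r → s < s' → s' < γ t → N t s < N t s' := fun t s s' ht hss' hs' =>
    nth_position_lt hss' (by rwa [hcount' t ht])
  have hsurj : ∀ p < A.size, ∃ s, f p < r ∧ s < γ (f p) ∧ N (f p) s = p := fun p hp => by
    obtain ⟨s, hs, hsp⟩ := exists_nth_position_eq hp rfl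
    rw [hcount' _ (hf.lt p hp)] at hs
    exact ⟨s, hf.lt p hp, hs, hsp⟩
  have hinj : ∀ t s s', t < r → s < γ t → s' < γ t → N t s = N t s' → s = s' := by
    intro t s s' ht hs hs' heq
    rcases lt_trichotomy s s' with hlt | hlt | hlt
    · have := hNlt t s s' ht hlt hs'
      omega
    · exact hlt
    · have := hNlt t s' s ht hlt hs
      omega
  let T : SYT A :=
    { entry := entry
      zero_off := fun c hc => if_neg hc
      mem_range := fun ⟨i, j⟩ hc => by
        obtain ⟨t, s, ht, hs, rfl, rfl⟩ := hcells i j hc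
        have := (hN t s ht hs).1
        rw [(hentry t s ht hs).2, mem_Icc]
        omega
      injOn := fun ⟨i, j⟩ hc ⟨i', j'⟩ hc' heq => by
        obtain ⟨t, s, ht, hs, rfl, rfl⟩ := hcells i j hc
        obtain ⟨t', s', ht', hs', rfl, rfl⟩ := hcells i' j' hc'
        rw [(hentry t s ht hs).2, (hentry t' s' ht' hs').2] at heq
        have heq' : N t s = N t' s' := by omega
        have h1 := (hN t s ht hs).2
        have h2 := (hN t' s' ht' hs').2
        obtain rfl : t = t' := by rw [← h1, ← h2, heq']
        rw [hinj t s s' ht hs hs' heq']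
      row_lt := fun i j j' hc hc' hjj' => by
        obtain ⟨t, s, ht, hs, rfl, rfl⟩ := hcells i j hc
        obtain ⟨t', s', ht', hs', heq, rfl⟩ := hcells _ j' hc'
        obtain rfl : t = t' := by omega
        rw [(hentry t s ht hs).2, (hentry t s' ht' hs').2]
        have := hNlt t s s' ht (by omega) hs'
        omega
      col_lt := fun i i' j hc hc' hii' => by
        obtain ⟨t, s, ht, hs, rfl, rfl⟩ := hcells i j hc
        obtain ⟨t', s', ht', hs', rfl, heq⟩ := hcells i' _ hc'
        obtain ⟨rfl, hs0⟩ := h.eq_of_mem_of_mem (t := t) (t' := t') (j := m t + s) (by omega) ht'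
          (by omega) (by omega)
        rw [(hentry t s ht hs).2, heq, (hentry (t + 1) s' ht' hs').2]
        have hov := h.overlap t ht'
        obtain ⟨p, q, hpq, hq, hp, hq'⟩ := hf.link t ht'
        obtain ⟨u, -, hu, hup⟩ := hsurj p (by omega)
        obtain ⟨v, -, hv, hvq⟩ := hsurj q hq
        rw [hp] at hu hup
        rw [hq'] at hv hvq
        have h1 : N t s ≤ N t u := by
          rcases (show s ≤ u by omega).eq_or_lt with rfl | hlt
          · exact le_rfl
          · exact (hNlt t s u ht hlt hu).le
        have h2 : N (t + 1) v ≤ N (t + 1) s' := by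
          rcases (show v ≤ s' by omega).eq_or_lt with rfl | hlt
          · exact le_rfl
          · exact (hNlt (t + 1) v s' ht' hlt hs').le
        omega }
  have hrow : ∀ c ∈ A.cells, c.1 = r₀ + f (T.entry c - 1) := fun ⟨i, j⟩ hc => by
    obtain ⟨t, s, ht, hs, rfl, rfl⟩ := hcells i j hc
    change r₀ + t = r₀ + f (entry _ - 1)
    rw [(hentry t s ht hs).2, Nat.add_sub_cancel_left, (hN t s ht hs).2]
  have hex : ∀ p < A.size, ∃ c ∈ A.cells, T.entry c = p + 1 := fun p hp => by
    obtain ⟨s, hr, hs, hp'⟩ := hsurj p hp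
    obtain ⟨h1, h2⟩ := hentry (f p) s hr hs
    exact ⟨_, h1, h2.trans (by rw [hp', add_comm])⟩
  refine ⟨T, fun k hk => ?_⟩
  obtain ⟨hk1, hk2⟩ := mem_Ico.1 hk
  rw [← hf.asc (k - 1) (by omega), Nat.sub_add_cancel hk1, SYT.descentSet, mem_filter]
  constructor
  · rintro ⟨-, c, hc, c', hc', h1, h2, h3⟩
    have h4 := hrow c hc
    have h5 := hrow c' hc'
    rw [h1] at h4
    rw [h2, Nat.add_sub_cancel] at h5
    omega
  · intro hlt
    obtain ⟨c, hc, h1⟩ := hex (k - 1) (by omega)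
    obtain ⟨c', hc', h2⟩ := hex k hk2
    have h4 := hrow c hc
    have h5 := hrow c' hc'
    rw [h1] at h4
    rw [h2] at h5
    simp only [Nat.add_sub_cancel] at h4 h5
    exact ⟨hk, c, hc, c', hc', by omega, h2, by omega⟩

lemma eq_of_zipWith_sub_eq {l l' : List ℕ} {a : ℕ} (h : (a :: l).IsChain (· ≤ ·))
    (h' : (a :: l').IsChain (· ≤ ·))
    (heq : List.zipWith (fun x y => x - y) l (a :: l) =
      List.zipWith (fun x y => x - y) l' (a :: l')) : l = l' := by
  induction l generalizing l' a with
  | nil =>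
    cases l' with
    | nil => rfl
    | cons x' l' => simp at heq
  | cons x l ih =>
    cases l' with
    | nil => simp at heq
    | cons x' l' =>
      rw [List.isChain_cons_cons] at h h'
      rw [List.zipWith_cons_cons, List.zipWith_cons_cons, List.cons.injEq] at heq
      obtain rfl : x = x' := by omega
      rw [ih h.2 h'.2 heq.2]

lemma isChain_sort_append {n : ℕ} {D : Finset ℕ} (hD : D ⊆ Ico 1 n) :
    (0 :: (D.sort (· ≤ ·) ++ [n])).IsChain (· ≤ ·) := by
  refine List.Pairwise.isChain (List.pairwise_cons.2 ⟨fun _ _ => Nat.zero_le _, ?_⟩)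
  refine List.pairwise_append.2 ⟨D.pairwise_sort _, List.pairwise_singleton _ _, ?_⟩
  intro a ha b hb
  rw [List.mem_singleton.1 hb]
  exact (mem_Ico.1 (hD ((mem_sort _).1 ha))).2.le

lemma compOfSet_inj {n : ℕ} {D D' : Finset ℕ} (hD : D ⊆ Ico 1 n) (hD' : D' ⊆ Ico 1 n)
    (h : compOfSet n D = compOfSet n D') : D = D' := by
  rcases Nat.eq_zero_or_pos n with rfl | hn
  · rw [subset_empty.1 hD, subset_empty.1 hD']
  · rw [compOfSet, compOfSet, if_neg hn.ne', if_neg hn.ne'] at h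
    have := eq_of_zipWith_sub_eq (isChain_sort_append hD) (isChain_sort_append hD') h
    rw [List.append_cancel_right_eq] at this
    ext x
    rw [← mem_sort (· ≤ ·), this, mem_sort]

lemma SYT.descentSet_subset_s12 {A : SkewShape} (T : SYT A) : T.descentSet ⊆ Ico 1 A.size :=
  filter_subset _ _

/-- A composition, given as a descent set `D`, lies in the F-support of a ribbon exactly when `D`
is realizable by the row lengths of the ribbon. -/
lemma compOfSet_mem_Fsupp_iff {A : SkewShape} {r₀ r : ℕ} {m γ : ℕ → ℕ}
    (h : IsRibbonRows A.cells r₀ r m γ) {D : Finset ℕ} (hD : D ⊆ Ico 1 A.size) :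
    compOfSet A.size D ∈ Fsupp A ↔
      Realizable A.size r (fun p => p + 1 ∈ D) fun i : Fin r => γ i := by
  constructor
  · rintro ⟨T, hT⟩
    rw [← compOfSet_inj T.descentSet_subset_s12 hD hT]
    exact T.realizable h
  · intro hreal
    obtain ⟨T, hT⟩ := hreal.exists_SYT h
    refine ⟨T, ?_⟩
    rw [SYT.descentComp]
    congr 1
    ext k
    by_cases hk : k ∈ Ico 1 A.size
    · rw [hT k hk, Nat.sub_add_cancel (mem_Ico.1 hk).1]
    · exact iff_of_false (fun h' => hk (T.descentSet_subset_s12 h')) fun h' => hk (hD h')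

/-- Inclusion of F-supports of ribbons in terms of the words of the row lengths. -/
lemma Fsupp_subset_iff {A B : SkewShape} {r₀ r r₀' r' : ℕ} {m γ m' γ' : ℕ → ℕ}
    (hA : IsRibbonRows A.cells r₀ r m γ) (hB : IsRibbonRows B.cells r₀' r' m' γ')
    (hsize : A.size = B.size) :
    Fsupp B ⊆ Fsupp A ↔ ∀ D, Realizable A.size r' D (fun i : Fin r' => γ' i) →
      Realizable A.size r D fun i : Fin r => γ i := by
  constructor
  · intro hsub D hD
    classical
    let E := (Ico 1 A.size).filter fun k => D (k - 1)
    have hE : E ⊆ Ico 1 A.size := filter_subset _ _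
    have hDE : ∀ p, p + 1 < A.size → (D p ↔ p + 1 ∈ E) := fun p hp => by
      rw [mem_filter, mem_Ico, Nat.add_sub_cancel]
      exact ⟨fun h => ⟨⟨by omega, hp⟩, h⟩, fun h => h.2⟩
    have h1 := hD.congr_ascents hDE
    have h2 := (compOfSet_mem_Fsupp_iff hB (hsize ▸ hE)).2 (hsize ▸ h1)
    rw [← hsize] at h2
    exact ((compOfSet_mem_Fsupp_iff hA hE).1 (hsub h2)).congr_ascents fun p hp => (hDE p hp).symm
  · rintro hreal _ ⟨T, rfl⟩
    have h1 := T.realizable hB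
    rw [← hsize] at h1
    rw [SYT.descentComp, ← hsize]
    exact (compOfSet_mem_Fsupp_iff hA (hsize ▸ T.descentSet_subset_s12)).2 (hreal _ h1)

/-- The comparison of realizable ascent sets for two contents of the same size. -/
lemma forall_realizable_imp_iff {n r r' : ℕ} {α : Fin r → ℕ} {β : Fin r' → ℕ}
    (hr : 0 < r') (hα : ∀ i, 2 ≤ α i) (hβ : ∀ i, 2 ≤ β i)
    (hαn : ∑ i, α i = n) (hβn : ∑ i, β i = n) :
    (∀ D, Realizable n r' D β → Realizable n r D α) ↔
      Dom (univ.val.map α) (univ.val.map β) ∧ r = r' := by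
  have hdom_card : Dom (univ.val.map α) (univ.val.map β) → r' ≤ r := fun hdom => by
    have := hdom.card_le (hαn.trans hβn.symm) fun x hx => by
      obtain ⟨i, -, rfl⟩ := Multiset.mem_map.1 hx
      have := hβ i
      omega
    simpa using this
  obtain ⟨σ, hσ⟩ := exists_perm_antitone α
  obtain ⟨τ, hτ⟩ := exists_perm_antitone β
  have hασ : ∑ i, (α ∘ σ) i = ∑ i, α i := Equiv.sum_comp σ α
  have hβτ : ∑ i, (β ∘ τ) i = ∑ i, β i := Equiv.sum_comp τ β
  have hsum : ∑ i, (α ∘ σ) i = ∑ i, (β ∘ τ) i := by rw [hασ, hβτ, hαn, hβn]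
  rw [← map_val_comp_perm α σ, ← map_val_comp_perm β τ] at hdom_card ⊢
  rw [dom_map_univ_iff hσ hτ] at hdom_card ⊢
  subst hβn
  constructor
  · intro himp
    obtain ⟨D, hD, hDle⟩ := exists_realizable_le β hβ hr
    obtain ⟨D', hD', hDmin⟩ := exists_realizable_sum_min_le β fun i => one_le_two.trans (hβ i)
    have hle := hDle r α (himp D hD)
    have hmin := hDmin r α (himp D' hD')
    have hdom := prefixSum_le_of_sum_min_le hτ hsum fun j => by
      have h1 : ∑ i, min ((α ∘ σ) i) j = ∑ i, min (α i) j := Equiv.sum_comp σ fun i => min (α i) j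
      have h2 : ∑ i, min ((β ∘ τ) i) j = ∑ i, min (β i) j := Equiv.sum_comp τ fun i => min (β i) j
      rw [h1, h2]
      exact hmin j
    exact ⟨hdom, hle.antisymm (hdom_card hdom)⟩
  · rintro ⟨hdom, rfl⟩ D hD
    have h1 := (hD.perm hβ τ).of_dominated (fun i => hβ _) hσ hsum hdom
    have h2 := h1.perm (fun i => hα _) σ⁻¹
    convert h2 using 1
    ext i
    simp

theorem stmt12 (A B : SkewShape)
    (hA : ElongatedRibbon A) (hB : ElongatedRibbon B) (hsize : A.size = B.size) :
    Fsupp B ⊆ Fsupp A ↔ ∀ k, 1 ≤ k → Dom (rowsk A.cells k) (rowsk B.cells k) := by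
  obtain ⟨r₀, r, m, γ, hA⟩ := hA.exists_isRibbonRows
  obtain ⟨r₀', r', m', γ', hB⟩ := hB.exists_isRibbonRows
  rw [Fsupp_subset_iff hA hB hsize, forall_realizable_imp_iff hB.pos (fun i => hA.two_le i i.2)
    (fun i => hB.two_le i i.2) (by rw [SkewShape.size, hA.card_eq, sum_range])
    (by rw [hsize, SkewShape.size, hB.card_eq, sum_range]), ← hA.rowsk_one, ← hB.rowsk_one]
  have hpos := hA.pos
  have hpos' := hB.pos
  constructor
  · rintro ⟨hdom, rfl⟩ k hk
    obtain rfl | rfl | hk : k = 1 ∨ k = 2 ∨ 3 ≤ k := by omega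
    · exact hdom
    · rw [hA.rowsk_two, hB.rowsk_two]
      exact fun j => le_rfl
    · rw [hA.rowsk_eq_zero hk, hB.rowsk_eq_zero hk]
      exact fun j => le_rfl
  · intro h
    have hdom := h 1 le_rfl
    refine ⟨hdom, ?_⟩
    have h2 := (h 2 one_le_two).sum_le
    rw [hA.rowsk_two, hB.rowsk_two] at h2
    simp only [Multiset.sum_replicate, smul_eq_mul, mul_one] at h2
    rw [hA.rowsk_one, hB.rowsk_one] at hdom
    have hcard := hdom.card_le ?_ ?_
    · simp only [Multiset.card_map, card_val, card_univ, Fintype.card_fin] at hcard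
      omega
    · change ∑ i : Fin r, γ i = ∑ i : Fin r', γ' i
      rw [← sum_range, ← sum_range, ← hA.card_eq, ← hB.card_eq]
      exact hsize
    · intro x hx
      obtain ⟨i, -, rfl⟩ := Multiset.mem_map.1 hx
      have := hB.two_le i i.2
      omega

end SkewPaper
end
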